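/- arXiv:1706.00460 — 2 statements merged into one kernel-verified Lean document; each statement's English description precedes it below -/
import Mathlib

section
/- Let n ≥ 3 be an integer, let Ω ⊂ ℝⁿ be a bounded open set with smooth boundary, and let w be a smooth positive function on a neighborhood of the closure of Ω and u a smooth positive function on the closure of Ω. Suppose: (i) R[w·u](x) ≥ R[w](x) for every x ∈ Ω; (ii) u = 1 on ∂Ω; (iii) ∂u/∂ν ≥ 0 on ∂Ω, where ν is the outward unit normal; (iv) Q(Ω,w) > 0 and ((n+2)/(4(n−1))) · (∫_Ω (max(R[w],0))^{n/2} w^{2n/(n−2)} dx)^{2/n} < Q(Ω,w). Then u ≡ 1 on Ω; equivalently, the conformal metric g = (w·u)^{4/(n−2)}·δ coincides with the background metric ḡ = w^{4/(n−2)}·δ on Ω. -/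
open MeasureTheory Real

/-- The Euclidean Laplacian of a function `u : ℝⁿ → ℝ`. -/
noncomputable def lap {n : ℕ} (u : EuclideanSpace ℝ (Fin n) → ℝ)
    (x : EuclideanSpace ℝ (Fin n)) : ℝ :=
  ∑ i : Fin n, fderiv ℝ (fun y => fderiv ℝ u y (EuclideanSpace.single i 1)) x
    (EuclideanSpace.single i 1)

/-- The scalar curvature `R[U] = -(4(n-1)/(n-2)) U^{-(n+2)/(n-2)} ΔU` of the
conformally flat metric `U^{4/(n-2)}·δ`. -/
noncomputable def Rcurv (n : ℕ) (U : EuclideanSpace ℝ (Fin n) → ℝ)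
    (x : EuclideanSpace ℝ (Fin n)) : ℝ :=
  -(4 * ((n : ℝ) - 1) / ((n : ℝ) - 2)) *
    (U x) ^ (-(((n : ℝ) + 2) / ((n : ℝ) - 2))) * lap U x

/-- `Ω` has smooth boundary, with outward unit normal field `ν` on `∂Ω`:
there is a smooth defining function `f` with `Ω = {f < 0}`, `∂Ω = {f = 0}`,
`∇f ≠ 0` on `∂Ω`, and `ν = ∇f/‖∇f‖` on `∂Ω`. -/
def SmoothBoundaryNormal {n : ℕ} (Ω : Set (EuclideanSpace ℝ (Fin n)))
    (ν : EuclideanSpace ℝ (Fin n) → EuclideanSpace ℝ (Fin n)) : Prop :=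
  ∃ f : EuclideanSpace ℝ (Fin n) → ℝ, ContDiff ℝ (⊤ : ℕ∞) f ∧
    Ω = {x | f x < 0} ∧ frontier Ω = {x | f x = 0} ∧
    ∀ x ∈ frontier Ω, gradient f x ≠ 0 ∧ ν x = ‖gradient f x‖⁻¹ • gradient f x

/-- The Sobolev (Yamabe) constant `Q(Ω, w)` of `Ω` relative to the conformally flat
metric `w^{4/(n-2)}·δ`, as an infimum over nonzero smooth compactly supported test
functions in `Ω`. -/
noncomputable def Qconst (n : ℕ) (Ω : Set (EuclideanSpace ℝ (Fin n)))
    (w : EuclideanSpace ℝ (Fin n) → ℝ) : ℝ :=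
  sInf { q : ℝ | ∃ φ : EuclideanSpace ℝ (Fin n) → ℝ, ContDiff ℝ (⊤ : ℕ∞) φ ∧
    HasCompactSupport φ ∧ tsupport φ ⊆ Ω ∧ φ ≠ 0 ∧
    q = (∫ x in Ω, ((w x) ^ 2 * ‖gradient φ x‖ ^ 2 +
          (((n : ℝ) - 2) / (4 * ((n : ℝ) - 1))) * Rcurv n w x *
            (w x) ^ ((2 * (n : ℝ)) / ((n : ℝ) - 2)) * (φ x) ^ 2)) /
        (∫ x in Ω, |φ x| ^ ((2 * (n : ℝ)) / ((n : ℝ) - 2)) *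
          (w x) ^ ((2 * (n : ℝ)) / ((n : ℝ) - 2))) ^ (((n : ℝ) - 2) / (n : ℝ)) }

open Set Filter
open scoped ContDiff Topology

section SoftPositivePart

/-- A smooth approximation from below of the positive part, vanishing on `(-∞, ε]`. -/
noncomputable def softPosPart (ε t : ℝ) : ℝ :=
  ∫ s in (0 : ℝ)..t, smoothTransition (s / ε - 1)

theorem hasDerivAt_softPosPart (ε t : ℝ) :
    HasDerivAt (softPosPart ε) (smoothTransition (t / ε - 1)) t := by
  have hc : Continuous fun s : ℝ => smoothTransition (s / ε - 1) :=
    smoothTransition.continuous.comp (by fun_prop)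
  exact intervalIntegral.integral_hasDerivAt_right (hc.intervalIntegrable _ _)
    hc.stronglyMeasurable.stronglyMeasurableAtFilter hc.continuousAt

theorem contDiff_smoothTransition_div_sub (ε : ℝ) :
    ContDiff ℝ ∞ fun t : ℝ => smoothTransition (t / ε - 1) :=
  smoothTransition.contDiff.comp (by fun_prop)

theorem contDiff_softPosPart (ε : ℝ) : ContDiff ℝ ∞ (softPosPart ε) := by
  rw [contDiff_infty_iff_deriv]
  refine ⟨fun t => (hasDerivAt_softPosPart ε t).differentiableAt, ?_⟩
  rw [show deriv (softPosPart ε) = fun t => smoothTransition (t / ε - 1) from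
    funext fun t => (hasDerivAt_softPosPart ε t).deriv]
  exact contDiff_smoothTransition_div_sub ε

theorem smoothTransition_div_sub_eq_zero {ε t : ℝ} (hε : 0 < ε) (ht : t ≤ ε) :
    smoothTransition (t / ε - 1) = 0 :=
  smoothTransition.zero_of_nonpos (by rw [sub_nonpos, div_le_one hε]; exact ht)

theorem softPosPart_eq_zero {ε t : ℝ} (hε : 0 < ε) (ht : t ≤ ε) : softPosPart ε t = 0 := by
  refine intervalIntegral.integral_zero_ae (Eventually.of_forall fun s hs => ?_)
  refine smoothTransition_div_sub_eq_zero hε ?_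
  rcases le_total 0 t with h | h
  · rw [uIoc_of_le h] at hs; exact hs.2.trans ht
  · rw [uIoc_of_ge h] at hs; exact hs.2.trans hε.le

theorem monotone_softPosPart (ε : ℝ) : Monotone (softPosPart ε) :=
  monotone_of_deriv_nonneg (fun t => (hasDerivAt_softPosPart ε t).differentiableAt) fun t => by
    rw [(hasDerivAt_softPosPart ε t).deriv]; exact smoothTransition.nonneg _

theorem softPosPart_nonneg {ε : ℝ} (hε : 0 < ε) (t : ℝ) : 0 ≤ softPosPart ε t := by
  rcases le_total t ε with h | h
  · exact (softPosPart_eq_zero hε h).ge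
  · exact (softPosPart_eq_zero hε le_rfl).ge.trans (monotone_softPosPart ε h)

theorem softPosPart_le_max {ε : ℝ} (hε : 0 < ε) (t : ℝ) : softPosPart ε t ≤ max t 0 := by
  have hd (t : ℝ) : HasDerivAt (fun t => t - softPosPart ε t)
      (1 - smoothTransition (t / ε - 1)) t := (hasDerivAt_id t).sub (hasDerivAt_softPosPart ε t)
  have hm : Monotone fun t => t - softPosPart ε t :=
    monotone_of_deriv_nonneg (fun t => (hd t).differentiableAt) fun t => by
      rw [(hd t).deriv]; exact sub_nonneg.2 (smoothTransition.le_one _)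
  rcases le_total t ε with h | h
  · exact (softPosPart_eq_zero hε h).le.trans (le_max_right _ _)
  · have := hm h
    simp only [softPosPart_eq_zero hε le_rfl] at this
    exact le_max_of_le_left (by linarith)

theorem sub_le_softPosPart {ε : ℝ} (hε : 0 < ε) (t : ℝ) : t - 2 * ε ≤ softPosPart ε t := by
  rcases le_total t (2 * ε) with h | h
  · exact (sub_nonpos.2 h).trans (softPosPart_nonneg hε t)
  · have hd (t : ℝ) : HasDerivAt (fun t => softPosPart ε t - t)
        (smoothTransition (t / ε - 1) - 1) t := (hasDerivAt_softPosPart ε t).sub (hasDerivAt_id t)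
    have hm : MonotoneOn (fun t => softPosPart ε t - t) (Ici (2 * ε)) := by
      refine monotoneOn_of_deriv_nonneg (convex_Ici _)
        (fun t _ => (hd t).continuousAt.continuousWithinAt)
        (fun t _ => (hd t).differentiableAt.differentiableWithinAt) fun t ht => ?_
      rw [(hd t).deriv, smoothTransition.one_of_one_le, sub_self]
      rw [interior_Ici, mem_Ioi] at ht
      have : 2 ≤ t / ε := by rw [le_div_iff₀ hε]; exact ht.le
      linarith
    have := hm self_mem_Ici h h
    simp only at this
    linarith [softPosPart_nonneg hε (2 * ε)]

theorem tendsto_softPosPart (t : ℝ) :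
    Tendsto (fun ε => softPosPart ε t) (𝓝[>] 0) (𝓝 (max t 0)) := by
  have hl : Tendsto (fun ε : ℝ => max t 0 - 2 * ε) (𝓝[>] 0) (𝓝 (max t 0)) := by
    have : Tendsto (fun ε : ℝ => max t 0 - 2 * ε) (𝓝 0) (𝓝 (max t 0 - 2 * 0)) :=
      Continuous.tendsto (by fun_prop) 0
    simpa using this.mono_left nhdsWithin_le_nhds
  refine tendsto_of_tendsto_of_tendsto_of_le_of_le' hl tendsto_const_nhds ?_ ?_
  · filter_upwards [self_mem_nhdsWithin] with ε hε
    have hε : 0 < ε := hε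
    rcases max_choice t 0 with h | h <;> rw [h]
    · exact sub_le_softPosPart hε t
    · linarith [softPosPart_nonneg hε t]
  · filter_upwards [self_mem_nhdsWithin] with ε hε
    exact softPosPart_le_max hε t

theorem hasDerivAt_smoothTransition_div_sub (ε t : ℝ) :
    HasDerivAt (fun t => smoothTransition (t / ε - 1))
      (deriv smoothTransition (t / ε - 1) / ε) t := by
  have h1 : HasDerivAt smoothTransition (deriv smoothTransition (t / ε - 1)) (t / ε - 1) :=
    ((smoothTransition.contDiff (n := 1)).differentiable (by norm_num) _).hasDerivAt
  have h2 : HasDerivAt (fun t : ℝ => t / ε - 1) (1 / ε) t :=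
    ((hasDerivAt_id t).div_const ε).sub_const 1
  simpa [div_eq_mul_inv, Function.comp_def] using HasDerivAt.comp t h1 h2

theorem deriv_smoothTransition_eq_zero {s : ℝ} (hs : s < 0 ∨ 1 < s) :
    deriv smoothTransition s = 0 := by
  rcases hs with hs | hs
  · have : smoothTransition =ᶠ[𝓝 s] fun _ => 0 := by
      filter_upwards [Iio_mem_nhds hs] with t ht
      exact smoothTransition.zero_of_nonpos (le_of_lt ht)
    rw [this.deriv_eq, deriv_const]
  · have : smoothTransition =ᶠ[𝓝 s] fun _ => 1 := by
      filter_upwards [Ioi_mem_nhds hs] with t ht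
      exact smoothTransition.one_of_one_le (le_of_lt ht)
    rw [this.deriv_eq, deriv_const]

theorem exists_abs_deriv_smoothTransition_le :
    ∃ B : ℝ, 0 ≤ B ∧ ∀ s, |deriv smoothTransition s| ≤ B := by
  have hc : Continuous (deriv smoothTransition) :=
    (smoothTransition.contDiff (n := 1)).continuous_deriv (by norm_num)
  obtain ⟨B, hB⟩ := (isCompact_Icc (a := (0 : ℝ)) (b := 1)).exists_bound_of_continuousOn
    hc.continuousOn
  refine ⟨B, (norm_nonneg _).trans (hB 0 (by simp)), fun s => ?_⟩
  by_cases hs : s ∈ Icc (0 : ℝ) 1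
  · exact hB s hs
  · rw [deriv_smoothTransition_eq_zero, abs_zero]
    · exact (norm_nonneg _).trans (hB 0 (by simp))
    · rw [mem_Icc, not_and_or, not_le, not_le] at hs; exact hs

end SoftPositivePart

section TestFunctions

theorem tsupport_indicator_comp_subset {E : Type*} [TopologicalSpace E] {Ω V : Set E} {h : E → ℝ} {θ : ℝ → ℝ} {ε : ℝ}
    (hVc : closure Ω ⊆ V) (hh : ContinuousOn h V) (hfr : ∀ x ∈ frontier Ω, h x = 0)
    (hΩ : IsOpen Ω) (hε : 0 < ε) (hθ : ∀ t ≤ ε, θ t = 0) :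
    tsupport (Ω.indicator (θ ∘ h)) ⊆ Ω := by
  have hK : IsClosed (closure Ω ∩ h ⁻¹' Ici ε) :=
    (hh.mono hVc).preimage_isClosed_of_isClosed isClosed_closure isClosed_Ici
  have hs : Function.support (Ω.indicator (θ ∘ h)) ⊆ closure Ω ∩ h ⁻¹' Ici ε := by
    intro x hx
    have hxΩ : x ∈ Ω := by
      by_contra hn
      exact hx (indicator_of_notMem hn _)
    refine ⟨subset_closure hxΩ, ?_⟩
    by_contra hn
    refine hx ?_
    rw [indicator_of_mem hxΩ]
    exact hθ _ (le_of_lt (not_le.1 hn))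
  intro x hx
  obtain ⟨hx1, hx2⟩ := closure_minimal hs hK hx
  by_contra hn
  have : x ∈ frontier Ω := by rw [hΩ.frontier_eq]; exact ⟨hx1, hn⟩
  have h2 : ε ≤ h x := hx2
  rw [hfr x this] at h2
  exact absurd h2 (not_le.2 hε)

variable {E : Type*} [NormedAddCommGroup E] [NormedSpace ℝ E]

theorem contDiff_indicator_of_tsupport_subset {Ω : Set E} {g : E → ℝ} {m : ℕ∞ω} (hΩ : IsOpen Ω)
    (hg : ContDiffOn ℝ m g Ω) (hs : tsupport (Ω.indicator g) ⊆ Ω) :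
    ContDiff ℝ m (Ω.indicator g) := by
  refine contDiff_iff_contDiffAt.2 fun x => ?_
  by_cases hxs : x ∈ tsupport (Ω.indicator g)
  swap
  · exact contDiffAt_const.congr_of_eventuallyEq (notMem_tsupport_iff_eventuallyEq.1 hxs)
  have hx := hs hxs
  refine (hg.contDiffAt (hΩ.mem_nhds hx)).congr_of_eventuallyEq ?_
  filter_upwards [hΩ.mem_nhds hx] with y hy
  exact indicator_of_mem hy _

theorem fderiv_indicator_of_mem {Ω : Set E} {g : E → ℝ} {x : E} (hΩ : IsOpen Ω) (hx : x ∈ Ω) :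
    fderiv ℝ (Ω.indicator g) x = fderiv ℝ g x := by
  refine Filter.EventuallyEq.fderiv_eq ?_
  filter_upwards [hΩ.mem_nhds hx] with y hy
  exact indicator_of_mem hy _

theorem ContDiffOn.fderiv_apply_of_isOpen {V : Set E} {h : E → ℝ} (hh : ContDiffOn ℝ ∞ h V)
    (hV : IsOpen V) (v : E) : ContDiffOn ℝ ∞ (fun y => fderiv ℝ h y v) V :=
  (hh.fderiv_of_isOpen hV (m := ∞) le_rfl).clm_apply contDiffOn_const

variable [FiniteDimensional ℝ E] [MeasurableSpace E] [BorelSpace E]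

theorem ContinuousOn.integrableOn_of_isBounded (μ : Measure E) [IsFiniteMeasureOnCompacts μ]
    {Ω : Set E} {g : E → ℝ}
    (hΩ : Bornology.IsBounded Ω) (hg : ContinuousOn g (closure Ω)) : IntegrableOn g Ω μ :=
  (hg.integrableOn_compact hΩ.isCompact_closure).mono_set subset_closure

theorem ContinuousOn.memLp_of_isBounded (μ : Measure E) [IsFiniteMeasureOnCompacts μ]
    {Ω : Set E} {g : E → ℝ} {p : ENNReal}
    (hΩ : Bornology.IsBounded Ω) (hΩo : IsOpen Ω) (hg : ContinuousOn g (closure Ω)) :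
    MemLp g p (μ.restrict Ω) := by
  have : IsFiniteMeasure (μ.restrict Ω) :=
    ⟨by rw [Measure.restrict_apply_univ]; exact hΩ.measure_lt_top⟩
  obtain ⟨C, hC⟩ := hΩ.isCompact_closure.exists_bound_of_continuousOn hg
  refine MemLp.of_bound (hg.integrableOn_of_isBounded μ hΩ).aestronglyMeasurable C ?_
  exact ae_restrict_of_forall_mem hΩo.measurableSet fun x hx => hC x (subset_closure hx)

/-- Integration by parts against a test function supported in a bounded open set. -/
theorem setIntegral_mul_fderiv_eq_neg {μ : Measure E} [μ.IsAddHaarMeasure]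
    {Ω V : Set E} {φ g : E → ℝ}
    (hΩ : Bornology.IsBounded Ω) (hV : IsOpen V) (hVc : closure Ω ⊆ V)
    (hφ : ContDiff ℝ 1 φ) (hs : tsupport φ ⊆ Ω) (hg : ContDiffOn ℝ 1 g V) (v : E) :
    ∫ x in Ω, φ x * fderiv ℝ g x v ∂μ = -∫ x in Ω, fderiv ℝ φ x v * g x ∂μ := by
  have hφ' : Continuous fun x => fderiv ℝ φ x v :=
    (hφ.continuous_fderiv (by norm_num)).clm_apply continuous_const
  have hg' : ContinuousOn (fun x => fderiv ℝ g x v) (closure Ω) :=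
    ((hg.continuousOn_fderiv_of_isOpen hV le_rfl).clm_apply continuousOn_const).mono hVc
  have hgc : ContinuousOn g (closure Ω) := hg.continuousOn.mono hVc
  have hz (x : E) (hx : x ∉ Ω) : φ x = 0 := image_eq_zero_of_notMem_tsupport fun h => hx (hs h)
  have hz' (x : E) (hx : x ∉ Ω) : fderiv ℝ φ x = 0 :=
    image_eq_zero_of_notMem_tsupport fun h => hx (hs (tsupport_fderiv_subset ℝ h))
  have key {G : E → ℝ} (hG : ContinuousOn G (closure Ω)) (h0 : ∀ x ∉ Ω, G x = 0) :
      Integrable G μ :=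
    (integrableOn_iff_integrable_of_support_subset fun x hx => by
      by_contra hn; exact hx (h0 x hn)).1 (hG.integrableOn_of_isBounded μ hΩ)
  rw [setIntegral_eq_integral_of_forall_compl_eq_zero fun x hx => by rw [hz x hx, zero_mul],
    setIntegral_eq_integral_of_forall_compl_eq_zero fun x hx => by simp [hz' x hx]]
  refine integral_mul_fderiv_eq_neg_fderiv_mul_of_integrable
    (key (hφ'.continuousOn.mul hgc) fun x hx => by simp [hz' x hx])
    (key (hφ.continuous.continuousOn.mul hg') fun x hx => by simp [hz x hx])
    (key (hφ.continuous.continuousOn.mul hgc) fun x hx => by simp [hz x hx])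
    (fun x _ => hφ.differentiable (by norm_num) x) fun x hx => ?_
  exact (hg.contDiffAt (hV.mem_nhds (hVc (subset_closure (hs hx))))).differentiableAt (by norm_num)

end TestFunctions

section Glaeser

variable {E : Type*} [NormedAddCommGroup E] [InnerProductSpace ℝ E]
  [FiniteDimensional ℝ E] [Nontrivial E]

/-- Glaeser's inequality for a nonnegative function whose derivative vanishes on the boundary. -/
theorem exists_norm_fderiv_sq_le {Ω V : Set E} {W : E → ℝ} (hΩo : IsOpen Ω)
    (hΩ : Bornology.IsBounded Ω) (hV : IsOpen V) (hVc : closure Ω ⊆ V)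
    (hW : ContDiffOn ℝ ∞ W V) (hpos : ∀ x ∈ Ω, 0 ≤ W x)
    (hfr : ∀ x ∈ frontier Ω, fderiv ℝ W x = 0) :
    ∃ C : ℝ, 0 ≤ C ∧ ∀ x ∈ Ω, ‖fderiv ℝ W x‖ ^ 2 ≤ C * W x := by
  have hW' : ContDiffOn ℝ ∞ (fderiv ℝ W) V := hW.fderiv_of_isOpen hV le_rfl
  obtain ⟨M₀, hM₀⟩ := hΩ.isCompact_closure.exists_bound_of_continuousOn
    ((hW'.continuousOn_fderiv_of_isOpen hV (by norm_num)).mono hVc)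
  obtain ⟨M, hMpos, hM⟩ : ∃ M : ℝ, 0 < M ∧ ∀ x ∈ closure Ω, ‖fderiv ℝ (fderiv ℝ W) x‖ ≤ M :=
    ⟨max M₀ 1, by positivity, fun x hx => (hM₀ x hx).trans (le_max_left _ _)⟩
  refine ⟨4 * M, by positivity, fun x hx => ?_⟩
  have hne : (Ωᶜ).Nonempty := by
    rw [nonempty_compl]
    rintro rfl
    exact NormedSpace.unbounded_univ ℝ E hΩ
  obtain ⟨z, hzΩ, hz⟩ := hΩo.isClosed_compl.exists_infDist_eq_dist hne x
  set r := Metric.infDist x Ωᶜ with hr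
  have hball : Metric.ball x r ⊆ Ω := Metric.ball_infDist_compl_subset
  have hrpos : 0 < r := (hΩo.isClosed_compl.notMem_iff_infDist_pos hne).1 fun h => h hx
  have hcball : Metric.closedBall x r ⊆ closure Ω := by
    rw [← closure_ball x hrpos.ne']; exact closure_mono hball
  have hzb : z ∈ Metric.closedBall x r := by rw [Metric.mem_closedBall, dist_comm, ← hz]
  have hxb : x ∈ Metric.closedBall x r := Metric.mem_closedBall_self hrpos.le
  have hzf : z ∈ frontier Ω := by rw [hΩo.frontier_eq]; exact ⟨hcball hzb, hzΩ⟩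
  have hdiff' : ∀ y ∈ closure Ω, DifferentiableAt ℝ (fderiv ℝ W) y := fun y hy =>
    (hW'.contDiffAt (hV.mem_nhds (hVc hy))).differentiableAt (by norm_num)
  have hdiff : ∀ y ∈ closure Ω, DifferentiableAt ℝ W y := fun y hy =>
    (hW.contDiffAt (hV.mem_nhds (hVc hy))).differentiableAt (by norm_num)
  have hlip : ∀ y ∈ Metric.closedBall x r, ‖fderiv ℝ W y - fderiv ℝ W x‖ ≤ M * ‖y - x‖ :=
    fun y hy => (convex_closedBall x r).norm_image_sub_le_of_norm_fderiv_le
      (fun y hy => hdiff' y (hcball hy)) (fun y hy => hM y (hcball hy)) hxb hy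
  set a := ‖fderiv ℝ W x‖ with ha
  have har : a ≤ M * r := by
    have := hlip z hzb
    rwa [hfr z hzf, zero_sub, norm_neg, ← dist_eq_norm, dist_comm, ← hz] at this
  rcases (norm_nonneg (fderiv ℝ W x)).eq_or_lt with h0 | h0
  · rw [ha, ← h0]
    simpa using mul_nonneg (by positivity : (0 : ℝ) ≤ 4 * M) (hpos x hx)
  have h0 : 0 < a := h0
  -- the unit vector in the direction of the gradient
  set G := (InnerProductSpace.toDual ℝ E).symm (fderiv ℝ W x) with hG
  have hGn : ‖G‖ = a := by rw [hG, LinearIsometryEquiv.norm_map]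
  have hGa : fderiv ℝ W x G = a ^ 2 := by
    have : fderiv ℝ W x G = inner ℝ G G := by
      rw [hG, InnerProductSpace.toDual_symm_apply]
    rw [this, real_inner_self_eq_norm_sq, hGn]
  set t := a / (2 * M) with ht
  have htpos : 0 < t := by positivity
  have htr : t < r := by
    rw [ht, div_lt_iff₀ (by positivity)]
    nlinarith [mul_pos hMpos hrpos]
  set y := x - (t / a) • G with hy
  have hyx : y - x = -((t / a) • G) := by rw [hy]; abel
  have hyn : ‖y - x‖ = t := by
    rw [hyx, norm_neg, norm_smul, hGn, Real.norm_of_nonneg (by positivity),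
      div_mul_cancel₀ _ h0.ne']
  have hyΩ : y ∈ Ω := hball (by rw [Metric.mem_ball, dist_eq_norm, hyn]; exact htr)
  have hsub : Metric.closedBall x t ⊆ Metric.closedBall x r := Metric.closedBall_subset_closedBall
    htr.le
  have hmv := (convex_closedBall x t).norm_image_sub_le_of_norm_fderiv_le'
    (f := W) (φ := fderiv ℝ W x) (C := a / 2) (x := x) (y := y)
    (fun y hy => hdiff y (hcball (hsub hy)))
    (fun y hy => by
      refine (hlip y (hsub hy)).trans ?_
      rw [Metric.mem_closedBall, dist_eq_norm] at hy
      calc M * ‖y - x‖ ≤ M * t := by gcongr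
        _ = a / 2 := by rw [ht]; field_simp)
    (Metric.mem_closedBall_self htpos.le)
    (by rw [Metric.mem_closedBall, dist_eq_norm, hyn])
  have hlin : fderiv ℝ W x (y - x) = -(t * a) := by
    rw [hyx, map_neg, map_smul, hGa, smul_eq_mul]
    field_simp
  rw [hyn, hlin, Real.norm_eq_abs] at hmv
  have h1 := (abs_le.1 hmv).2
  have h2 := hpos y hyΩ
  have h3 : t * a / 2 ≤ W x := by linarith
  have h4 : t * a / 2 = a ^ 2 / (4 * M) := by rw [ht]; field_simp; norm_num
  rw [h4, div_le_iff₀ (by positivity)] at h3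
  linarith

end Glaeser

section Laplacian

variable {n : ℕ}

theorem norm_gradient_eq (f : EuclideanSpace ℝ (Fin n) → ℝ) (x : EuclideanSpace ℝ (Fin n)) :
    ‖gradient f x‖ = ‖fderiv ℝ f x‖ := by
  rw [gradient, LinearIsometryEquiv.norm_map]

theorem norm_gradient_sq (f : EuclideanSpace ℝ (Fin n) → ℝ) (x : EuclideanSpace ℝ (Fin n)) :
    ‖gradient f x‖ ^ 2 = ∑ i, fderiv ℝ f x (EuclideanSpace.single i 1) ^ 2 := by
  rw [EuclideanSpace.norm_sq_eq]
  refine Finset.sum_congr rfl fun i _ => ?_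
  have h : fderiv ℝ f x (EuclideanSpace.single i 1) = gradient f x i := by
    have h : inner ℝ (gradient f x) (EuclideanSpace.single i (1 : ℝ)) =
        fderiv ℝ f x (EuclideanSpace.single i 1) := by
      rw [gradient, InnerProductSpace.toDual_symm_apply]
    rw [← h, EuclideanSpace.inner_single_right]
    simp
  rw [h, Real.norm_eq_abs, sq_abs]

theorem ContDiffOn.continuousOn_lap {O : Set (EuclideanSpace ℝ (Fin n))}
    {h : EuclideanSpace ℝ (Fin n) → ℝ} (hh : ContDiffOn ℝ ∞ h O) (hO : IsOpen O) :
    ContinuousOn (lap h) O :=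
  continuousOn_finsetSum _ fun i _ => ((hh.fderiv_apply_of_isOpen hO
    (EuclideanSpace.single i 1)).fderiv_apply_of_isOpen hO (EuclideanSpace.single i 1)).continuousOn

variable {O : Set (EuclideanSpace ℝ (Fin n))} {w u : EuclideanSpace ℝ (Fin n) → ℝ}
  {x : EuclideanSpace ℝ (Fin n)}

theorem ContDiffOn.differentiableAt_of_isOpen (hw : ContDiffOn ℝ ∞ w O) (hO : IsOpen O)
    (hx : x ∈ O) : DifferentiableAt ℝ w x :=
  (hw.contDiffAt (hO.mem_nhds hx)).differentiableAt (by norm_num)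

theorem fderiv_mul_apply (hw : DifferentiableAt ℝ w x) (hu : DifferentiableAt ℝ u x)
    (v : EuclideanSpace ℝ (Fin n)) :
    fderiv ℝ (fun y => w y * u y) x v = w x * fderiv ℝ u x v + u x * fderiv ℝ w x v := by
  rw [fderiv_fun_mul hw hu]
  simp

theorem lap_sub (hO : IsOpen O) (hw : ContDiffOn ℝ ∞ w O) (hu : ContDiffOn ℝ ∞ u O) (hx : x ∈ O) :
    lap (fun y => w y - u y) x = lap w x - lap u x := by
  unfold lap
  rw [← Finset.sum_sub_distrib]
  refine Finset.sum_congr rfl fun i _ => ?_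
  have h : (fun y => fderiv ℝ (fun y => w y - u y) y (EuclideanSpace.single i 1)) =ᶠ[𝓝 x]
      fun y => fderiv ℝ w y (EuclideanSpace.single i 1) -
        fderiv ℝ u y (EuclideanSpace.single i 1) := by
    filter_upwards [hO.mem_nhds hx] with y hy
    rw [fderiv_fun_sub (hw.differentiableAt_of_isOpen hO hy) (hu.differentiableAt_of_isOpen hO hy)]
    rfl
  rw [h.fderiv_eq, fderiv_fun_sub
    ((hw.fderiv_apply_of_isOpen hO _).differentiableAt_of_isOpen hO hx)
    ((hu.fderiv_apply_of_isOpen hO _).differentiableAt_of_isOpen hO hx)]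
  rfl

/-- The conformal transformation law of the Laplacian in divergence form. -/
theorem sum_fderiv_sq_mul_fderiv (hO : IsOpen O) (hw : ContDiffOn ℝ ∞ w O)
    (hu : ContDiffOn ℝ ∞ u O) (hx : x ∈ O) :
    ∑ i, fderiv ℝ (fun y => w y ^ 2 * fderiv ℝ u y (EuclideanSpace.single i 1)) x
      (EuclideanSpace.single i 1) = w x * lap (fun y => w y * u y) x - u x * w x * lap w x := by
  unfold lap
  rw [Finset.mul_sum, Finset.mul_sum, ← Finset.sum_sub_distrib]
  refine Finset.sum_congr rfl fun i _ => ?_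
  set e : EuclideanSpace ℝ (Fin n) := EuclideanSpace.single i 1
  have hw' := hw.fderiv_apply_of_isOpen hO e
  have hu' := hu.fderiv_apply_of_isOpen hO e
  have dw := hw.differentiableAt_of_isOpen hO hx
  have du := hu.differentiableAt_of_isOpen hO hx
  have dw' := hw'.differentiableAt_of_isOpen hO hx
  have du' := hu'.differentiableAt_of_isOpen hO hx
  have h : (fun y => fderiv ℝ (fun y => w y * u y) y e) =ᶠ[𝓝 x]
      fun y => w y * fderiv ℝ u y e + u y * fderiv ℝ w y e := by
    filter_upwards [hO.mem_nhds hx] with y hy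
    exact fderiv_mul_apply (hw.differentiableAt_of_isOpen hO hy)
      (hu.differentiableAt_of_isOpen hO hy) e
  have h2 : (fun y => w y ^ 2 * fderiv ℝ u y e) = fun y => w y * (w y * fderiv ℝ u y e) := by
    funext y; ring
  rw [h.fderiv_eq, fderiv_fun_add (dw.fun_mul du') (du.fun_mul dw'), h2,
    fderiv_mul_apply dw (dw.fun_mul du'), add_apply, fderiv_mul_apply dw du',
    fderiv_mul_apply du dw']
  ring

end Laplacian

section UniqueContinuation

variable {n : ℕ}

theorem fderiv_exp_mul_coord (c : ℝ) (i₀ : Fin n) (x v : EuclideanSpace ℝ (Fin n)) :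
    fderiv ℝ (fun y : EuclideanSpace ℝ (Fin n) => Real.exp (c * y i₀)) x v =
      c * Real.exp (c * x i₀) * v i₀ := by
  have h1 : HasFDerivAt (fun y : EuclideanSpace ℝ (Fin n) => c * y i₀)
      (c • (EuclideanSpace.proj i₀ : EuclideanSpace ℝ (Fin n) →L[ℝ] ℝ)) x :=
    (EuclideanSpace.proj i₀ : EuclideanSpace ℝ (Fin n) →L[ℝ] ℝ).hasFDerivAt.const_mul c
  rw [h1.exp.fderiv]
  simp
  ring

theorem contDiff_exp_mul_coord (c : ℝ) (i₀ : Fin n) :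
    ContDiff ℝ ∞ fun y : EuclideanSpace ℝ (Fin n) => Real.exp (c * y i₀) :=
  (contDiff_const.mul
    (EuclideanSpace.proj i₀ : EuclideanSpace ℝ (Fin n) →L[ℝ] ℝ).contDiff).exp

variable {Ω V : Set (EuclideanSpace ℝ (Fin n))} {W : EuclideanSpace ℝ (Fin n) → ℝ}

/-- Testing the Laplacian of the truncation of `W` at level `ε` against an exponential. -/
theorem sq_mul_setIntegral_softPosPart_mul_exp (hΩo : IsOpen Ω) (hΩ : Bornology.IsBounded Ω)
    (hV : IsOpen V) (hVc : closure Ω ⊆ V) (hW : ContDiffOn ℝ ∞ W V)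
    (hfr : ∀ x ∈ frontier Ω, W x = 0) (i₀ : Fin n) (c : ℝ) {ε : ℝ} (hε : 0 < ε) :
    c ^ 2 * ∫ x in Ω, softPosPart ε (W x) * Real.exp (c * x i₀) =
      ∫ x in Ω, (smoothTransition (W x / ε - 1) * lap W x +
        deriv smoothTransition (W x / ε - 1) / ε * ‖gradient W x‖ ^ 2) *
          Real.exp (c * x i₀) := by
  set ψ : EuclideanSpace ℝ (Fin n) → ℝ := fun y => Real.exp (c * y i₀) with hψ
  have hψs : ContDiff ℝ ∞ ψ := contDiff_exp_mul_coord c i₀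
  have hψ' : ∀ x v, fderiv ℝ ψ x v = c * ψ x * v i₀ := fderiv_exp_mul_coord c i₀
  have hΩV : Ω ⊆ V := subset_closure.trans hVc
  have dW : ∀ x ∈ Ω, DifferentiableAt ℝ W x := fun x hx =>
    hW.differentiableAt_of_isOpen hV (hΩV hx)
  set σ : ℝ → ℝ := fun t => smoothTransition (t / ε - 1) with hσ
  set σ' : ℝ → ℝ := fun t => deriv smoothTransition (t / ε - 1) / ε with hσ'
  have hσc : Continuous σ := (contDiff_smoothTransition_div_sub ε).continuous
  have hσ'c : Continuous σ' := by
    have hc : Continuous (deriv smoothTransition) :=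
      (smoothTransition.contDiff (n := 1)).continuous_deriv (by norm_num)
    exact (hc.comp (by fun_prop)).div_const ε
  set φ := Ω.indicator (softPosPart ε ∘ W)
  set θ := Ω.indicator (σ ∘ W)
  have hφs : tsupport φ ⊆ Ω := tsupport_indicator_comp_subset hVc hW.continuousOn hfr hΩo hε
    fun t ht => softPosPart_eq_zero hε ht
  have hθs : tsupport θ ⊆ Ω := tsupport_indicator_comp_subset hVc hW.continuousOn hfr hΩo hε
    fun t ht => smoothTransition_div_sub_eq_zero hε ht
  have hφd : ContDiff ℝ ∞ φ := contDiff_indicator_of_tsupport_subset hΩo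
    ((contDiff_softPosPart ε).comp_contDiffOn (hW.mono hΩV)) hφs
  have hθd : ContDiff ℝ ∞ θ := contDiff_indicator_of_tsupport_subset hΩo
    ((contDiff_smoothTransition_div_sub ε).comp_contDiffOn (hW.mono hΩV)) hθs
  have hφ' : ∀ x ∈ Ω, ∀ v, fderiv ℝ φ x v = σ (W x) * fderiv ℝ W x v := fun x hx v => by
    rw [fderiv_indicator_of_mem hΩo hx,
      ((hasDerivAt_softPosPart ε (W x)).comp_hasFDerivAt x (dW x hx).hasFDerivAt).fderiv]
    rfl
  have hθ' : ∀ x ∈ Ω, ∀ v, fderiv ℝ θ x v = σ' (W x) * fderiv ℝ W x v := fun x hx v => by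
    rw [fderiv_indicator_of_mem hΩo hx,
      ((hasDerivAt_smoothTransition_div_sub ε (W x)).comp_hasFDerivAt x
        (dW x hx).hasFDerivAt).fderiv]
    rfl
  have hψc : ContinuousOn ψ (closure Ω) := hψs.continuous.continuousOn
  have hWc : ContinuousOn W (closure Ω) := hW.continuousOn.mono hVc
  have hσW : ContinuousOn (fun x => σ (W x)) (closure Ω) := hσc.comp_continuousOn hWc
  have hσ'W : ContinuousOn (fun x => σ' (W x)) (closure Ω) := hσ'c.comp_continuousOn hWc
  have hWi (v) : ContDiffOn ℝ ∞ (fun y => fderiv ℝ W y v) V := hW.fderiv_apply_of_isOpen hV v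
  have hWic (v) : ContinuousOn (fun y => fderiv ℝ W y v) (closure Ω) :=
    (hWi v).continuousOn.mono hVc
  have hlapc : ContinuousOn (lap W) (closure Ω) := (hW.continuousOn_lap hV).mono hVc
  -- first integration by parts
  have h1 : c * ∫ x in Ω, softPosPart ε (W x) * ψ x =
      -∫ x in Ω, σ (W x) * fderiv ℝ W x (EuclideanSpace.single i₀ 1) * ψ x := by
    have h := setIntegral_mul_fderiv_eq_neg (μ := volume) hΩ hV hVc (hφd.of_le (by norm_num)) hφs
      (hψs.contDiffOn.of_le (by norm_num)) (EuclideanSpace.single i₀ 1)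
    rw [← integral_const_mul]
    refine Eq.trans ?_ (h.trans ?_)
    · refine setIntegral_congr_fun hΩo.measurableSet fun x hx => ?_
      simp only [hψ', φ, indicator_of_mem hx]
      simp
      ring
    · congr 1
      refine setIntegral_congr_fun hΩo.measurableSet fun x hx => ?_
      simp only [hφ' x hx]
  -- second integration by parts
  have h2 (i : Fin n) :
      ∫ x in Ω, σ (W x) * fderiv ℝ (fun y => ψ y * fderiv ℝ W y (EuclideanSpace.single i 1)) x
        (EuclideanSpace.single i 1) =
      -∫ x in Ω, σ' (W x) * fderiv ℝ W x (EuclideanSpace.single i 1) ^ 2 * ψ x := by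
    have h := setIntegral_mul_fderiv_eq_neg (μ := volume) hΩ hV hVc (hθd.of_le (by norm_num)) hθs
      ((hψs.contDiffOn.mul (hWi (EuclideanSpace.single i 1))).of_le (by norm_num))
      (EuclideanSpace.single i 1)
    refine Eq.trans ?_ (h.trans ?_)
    · refine setIntegral_congr_fun hΩo.measurableSet fun x hx => ?_
      simp only [θ, indicator_of_mem hx]
      rfl
    · congr 1
      refine setIntegral_congr_fun hΩo.measurableSet fun x hx => ?_
      simp only [hθ' x hx]
      ring
  have h3 := Finset.sum_congr rfl fun i (_ : i ∈ Finset.univ) => h2 i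
  rw [Finset.sum_neg_distrib, ← integral_finsetSum, ← integral_finsetSum] at h3
  rotate_left
  · intro i _
    exact ((hσ'W.mul ((hWic _).pow 2)).mul hψc).integrableOn_of_isBounded volume hΩ
  · intro i _
    exact (hσW.mul (((hψs.contDiffOn.mul (hWi (EuclideanSpace.single i 1))).fderiv_apply_of_isOpen
      hV _).continuousOn.mono hVc)).integrableOn_of_isBounded volume hΩ
  have h4 : ∫ x in Ω, ∑ i, σ (W x) *
        fderiv ℝ (fun y => ψ y * fderiv ℝ W y (EuclideanSpace.single i 1)) x
          (EuclideanSpace.single i 1) =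
      c * (∫ x in Ω, σ (W x) * fderiv ℝ W x (EuclideanSpace.single i₀ 1) * ψ x) +
        ∫ x in Ω, σ (W x) * lap W x * ψ x := by
    rw [← integral_const_mul, ← integral_add
      ((((hσW.fun_mul (hWic _)).fun_mul hψc).integrableOn_of_isBounded volume hΩ).const_mul c)
      (((hσW.fun_mul hlapc).fun_mul hψc).integrableOn_of_isBounded volume hΩ)]
    refine setIntegral_congr_fun hΩo.measurableSet fun x hx => ?_
    have hi (i : Fin n) : σ (W x) *
        fderiv ℝ (fun y => ψ y * fderiv ℝ W y (EuclideanSpace.single i 1)) x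
          (EuclideanSpace.single i 1) =
        (if i = i₀ then c * (σ (W x) * fderiv ℝ W x (EuclideanSpace.single i 1) * ψ x) else 0) +
        σ (W x) * ψ x * fderiv ℝ (fun y => fderiv ℝ W y (EuclideanSpace.single i 1)) x
          (EuclideanSpace.single i 1) := by
      rw [fderiv_mul_apply (hψs.differentiable (by norm_num) x)
        ((hWi _).differentiableAt_of_isOpen hV (hΩV hx)), hψ']
      by_cases h : i = i₀
      · subst h; simp; ring
      · simp [h, Ne.symm h]; ring
    simp only [hi]
    rw [Finset.sum_add_distrib, Finset.sum_ite_eq' Finset.univ i₀, ← Finset.mul_sum]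
    simp only [Finset.mem_univ, if_true, lap]
    ring
  have h5 : ∫ x in Ω, ∑ i, σ' (W x) * fderiv ℝ W x (EuclideanSpace.single i 1) ^ 2 * ψ x =
      ∫ x in Ω, σ' (W x) * ‖gradient W x‖ ^ 2 * ψ x := by
    refine setIntegral_congr_fun hΩo.measurableSet fun x hx => ?_
    simp only [norm_gradient_sq, Finset.mul_sum, Finset.sum_mul]
  have h6 : ∫ x in Ω, (σ (W x) * lap W x + σ' (W x) * ‖gradient W x‖ ^ 2) * ψ x =
      (∫ x in Ω, σ (W x) * lap W x * ψ x) + ∫ x in Ω, σ' (W x) * ‖gradient W x‖ ^ 2 * ψ x := by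
    rw [← integral_add (((hσW.fun_mul hlapc).fun_mul hψc).integrableOn_of_isBounded volume hΩ)]
    · simp only [add_mul]
    · refine ((hσ'W.mul ?_).mul hψc).integrableOn_of_isBounded volume hΩ
      simp only [norm_gradient_sq]
      exact continuousOn_finsetSum _ fun i _ => (hWic _).pow 2
  rw [h4, h5] at h3
  rw [h6, sq, mul_assoc, h1]
  linarith

/-- A nonnegative solution of `ΔW ≤ K W` with vanishing Cauchy data on the boundary is zero. -/
theorem eq_zero_of_lap_le_of_cauchy_data_eq_zero (hΩo : IsOpen Ω) (hΩ : Bornology.IsBounded Ω)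
    (hV : IsOpen V) (hVc : closure Ω ⊆ V) (hW : ContDiffOn ℝ ∞ W V) (i₀ : Fin n)
    (hpos : ∀ x ∈ Ω, 0 ≤ W x) (hfr : ∀ x ∈ frontier Ω, W x = 0)
    (hfr' : ∀ x ∈ frontier Ω, fderiv ℝ W x = 0) {K : ℝ} (hK : 0 ≤ K)
    (hlap : ∀ x ∈ Ω, lap W x ≤ K * W x) : ∀ x ∈ Ω, W x = 0 := by
  have : Nontrivial (EuclideanSpace ℝ (Fin n)) :=
    ⟨EuclideanSpace.single i₀ 1, 0, by simp⟩
  obtain ⟨C, hC, hCW⟩ := exists_norm_fderiv_sq_le hΩo hΩ hV hVc hW hpos hfr'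
  obtain ⟨B, hB, hBσ⟩ := exists_abs_deriv_smoothTransition_le
  set c := K + 1 with hc
  set ψ : EuclideanSpace ℝ (Fin n) → ℝ := fun y => Real.exp (c * y i₀) with hψ
  have hψpos (x) : 0 < ψ x := Real.exp_pos _
  have hψc : ContinuousOn ψ (closure Ω) := (contDiff_exp_mul_coord c i₀).continuous.continuousOn
  have hWc : ContinuousOn W (closure Ω) := hW.continuousOn.mono hVc
  have hψi : IntegrableOn ψ Ω := hψc.integrableOn_of_isBounded volume hΩ
  have hWψi : IntegrableOn (fun x => W x * ψ x) Ω :=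
    (hWc.mul hψc).integrableOn_of_isBounded volume hΩ
  have hWm : AEStronglyMeasurable W (volume.restrict Ω) :=
    (hWc.integrableOn_of_isBounded volume hΩ).aestronglyMeasurable
  let b : ℝ → EuclideanSpace ℝ (Fin n) → ℝ := fun ε x =>
    (Icc ε (2 * ε)).indicator (fun _ => (1 : ℝ)) (W x) * ψ x
  have hbm (ε : ℝ) : AEStronglyMeasurable (b ε) (volume.restrict Ω) :=
    (((measurable_const.indicator measurableSet_Icc).comp_aemeasurable
      hWm.aemeasurable).aestronglyMeasurable).mul hψi.aestronglyMeasurable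
  have hbψ (ε x) : ‖b ε x‖ ≤ ψ x := by
    simp only [b, indicator]
    split_ifs
    · simp [abs_of_pos (hψpos x)]
    · simpa using (hψpos x).le
  have hbi (ε : ℝ) : IntegrableOn (b ε) Ω :=
    hψi.mono' (hbm ε) (Eventually.of_forall (hbψ ε))
  have hbl : Tendsto (fun ε => ∫ x in Ω, b ε x) (𝓝[>] 0) (𝓝 0) := by
    have := tendsto_integral_filter_of_dominated_convergence (μ := volume.restrict Ω)
      (l := 𝓝[>] (0 : ℝ)) (F := b) (f := fun _ => 0) ψ (Eventually.of_forall hbm)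
      (Eventually.of_forall fun ε => Eventually.of_forall (hbψ ε)) hψi ?_
    · simpa using this
    refine ae_restrict_of_forall_mem hΩo.measurableSet fun x hx => ?_
    refine tendsto_const_nhds.congr' ?_
    rcases (hpos x hx).eq_or_lt with h0 | h0
    · filter_upwards [self_mem_nhdsWithin] with ε hε
      have hε : 0 < ε := hε
      simp only [b]
      rw [indicator_of_notMem, zero_mul]
      rw [← h0]
      exact fun h => absurd h.1 (not_le.2 hε)
    · filter_upwards [nhdsWithin_le_nhds (Iio_mem_nhds (half_pos h0))] with ε hε
      have hε : ε < W x / 2 := hε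
      simp only [b]
      rw [indicator_of_notMem, zero_mul]
      exact fun h => absurd h.2 (not_le.2 (by linarith))
  have hsl : Tendsto (fun ε => ∫ x in Ω, softPosPart ε (W x) * ψ x) (𝓝[>] 0)
      (𝓝 (∫ x in Ω, W x * ψ x)) := by
    refine tendsto_integral_filter_of_dominated_convergence (fun x => W x * ψ x)
      (Eventually.of_forall fun ε => ?_) ?_ hWψi ?_
    · exact ((((contDiff_softPosPart ε).continuous.comp_continuousOn hWc).mul
        hψc).integrableOn_of_isBounded volume hΩ).aestronglyMeasurable
    · filter_upwards [self_mem_nhdsWithin] with ε hε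
      refine ae_restrict_of_forall_mem hΩo.measurableSet fun x hx => ?_
      rw [Real.norm_of_nonneg (mul_nonneg (softPosPart_nonneg hε _) (hψpos x).le)]
      have := softPosPart_le_max hε (W x)
      rw [max_eq_left (hpos x hx)] at this
      exact mul_le_mul_of_nonneg_right this (hψpos x).le
    · refine ae_restrict_of_forall_mem hΩo.measurableSet fun x hx => ?_
      have := tendsto_softPosPart (W x)
      rw [max_eq_left (hpos x hx)] at this
      exact this.mul_const _
  have hineq : ∀ᶠ ε in 𝓝[>] (0 : ℝ), c ^ 2 * ∫ x in Ω, softPosPart ε (W x) * ψ x ≤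
      K * (∫ x in Ω, W x * ψ x) + 2 * B * C * ∫ x in Ω, b ε x := by
    filter_upwards [self_mem_nhdsWithin] with ε hε
    have hε : 0 < ε := hε
    rw [sq_mul_setIntegral_softPosPart_mul_exp hΩo hΩ hV hVc hW hfr i₀ c hε, ← integral_const_mul,
      ← integral_const_mul, ← integral_add (hWψi.const_mul K) ((hbi ε).const_mul _)]
    have hgradc : ContinuousOn (fun x => ‖gradient W x‖ ^ 2) (closure Ω) := by
      simp only [norm_gradient_sq]
      exact continuousOn_finsetSum _ fun i _ =>
        ((hW.fderiv_apply_of_isOpen hV _).continuousOn.mono hVc).pow 2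
    have hdc : Continuous fun t : ℝ => deriv smoothTransition (t / ε - 1) / ε := by
      have hc : Continuous (deriv smoothTransition) :=
        (smoothTransition.contDiff (n := 1)).continuous_deriv (by norm_num)
      exact (hc.comp (by fun_prop)).div_const ε
    refine setIntegral_mono_on (((((contDiff_smoothTransition_div_sub
      ε).continuous.comp_continuousOn hWc).mul ((hW.continuousOn_lap hV).mono hVc)).add
      ((hdc.comp_continuousOn hWc).mul hgradc)).mul hψc |>.integrableOn_of_isBounded volume hΩ)
      ((hWψi.const_mul K).add ((hbi ε).const_mul _)) hΩo.measurableSet fun x hx => ?_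
    have hW0 := hpos x hx
    have e1 : smoothTransition (W x / ε - 1) * lap W x ≤ K * W x := by
      have hs0 := smoothTransition.nonneg (W x / ε - 1)
      have hs1 := smoothTransition.le_one (W x / ε - 1)
      calc smoothTransition (W x / ε - 1) * lap W x
          ≤ smoothTransition (W x / ε - 1) * (K * W x) :=
            mul_le_mul_of_nonneg_left (hlap x hx) hs0
        _ ≤ 1 * (K * W x) := mul_le_mul_of_nonneg_right hs1 (mul_nonneg hK hW0)
        _ = K * W x := one_mul _
    have e2 : deriv smoothTransition (W x / ε - 1) / ε * ‖gradient W x‖ ^ 2 ≤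
        2 * B * C * (Icc ε (2 * ε)).indicator (fun _ => (1 : ℝ)) (W x) := by
      by_cases hmem : W x ∈ Icc ε (2 * ε)
      · rw [indicator_of_mem hmem, norm_gradient_eq, mul_one]
        have hd : deriv smoothTransition (W x / ε - 1) ≤ B := (le_abs_self _).trans (hBσ _)
        have hg : ‖fderiv ℝ W x‖ ^ 2 ≤ C * (2 * ε) :=
          (hCW x hx).trans (mul_le_mul_of_nonneg_left hmem.2 hC)
        calc deriv smoothTransition (W x / ε - 1) / ε * ‖fderiv ℝ W x‖ ^ 2
            ≤ B / ε * (C * (2 * ε)) := by gcongr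
          _ = 2 * B * C := by field_simp
      · rw [indicator_of_notMem hmem, deriv_smoothTransition_eq_zero]
        · simp
        · rw [mem_Icc, not_and_or, not_le, not_le] at hmem
          rcases hmem with h | h
          · left; rw [sub_neg, div_lt_one hε]; exact h
          · right
            have : 2 < W x / ε := by rw [lt_div_iff₀ hε]; exact h
            linarith
    calc (smoothTransition (W x / ε - 1) * lap W x +
          deriv smoothTransition (W x / ε - 1) / ε * ‖gradient W x‖ ^ 2) * ψ x
        ≤ (K * W x + 2 * B * C * (Icc ε (2 * ε)).indicator (fun _ => (1 : ℝ)) (W x)) * ψ x :=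
          mul_le_mul_of_nonneg_right (add_le_add e1 e2) (hψpos x).le
      _ = K * (W x * ψ x) + 2 * B * C * b ε x := by simp only [b]; ring
  have hlim := le_of_tendsto_of_tendsto (hsl.const_mul (c ^ 2))
    ((hbl.const_mul (2 * B * C)).const_add (K * ∫ x in Ω, W x * ψ x)) hineq
  have hnn : 0 ≤ᵐ[volume.restrict Ω] fun x => W x * ψ x :=
    ae_restrict_of_forall_mem hΩo.measurableSet fun x hx => mul_nonneg (hpos x hx) (hψpos x).le
  have hzero_int : ∫ x in Ω, W x * ψ x = 0 := by
    have h0 : 0 ≤ ∫ x in Ω, W x * ψ x := integral_nonneg_of_ae hnn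
    have hck : K < c ^ 2 := by rw [hc]; nlinarith
    nlinarith
  have hae := (setIntegral_eq_zero_iff_of_nonneg_ae hnn hWψi).1 hzero_int
  have heq := Measure.eqOn_open_of_ae_eq hae hΩo ((hWc.mul hψc).mono subset_closure)
    continuousOn_const
  intro x hx
  have := heq hx
  simpa [(hψpos x).ne'] using this

end UniqueContinuation

section Boundary

variable {E : Type*} [NormedAddCommGroup E] [NormedSpace ℝ E] {f u : E → ℝ} {x d : E}

theorem eventually_lt_of_fderiv_neg (hf : DifferentiableAt ℝ f x) (hd : fderiv ℝ f x d < 0) :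
    ∀ᶠ t in 𝓝[>] (0 : ℝ), f (x + t • d) < f x := by
  have h : HasDerivAt (fun t : ℝ => f (x + t • d)) (fderiv ℝ f x d) 0 :=
    hf.hasFDerivAt.hasLineDerivAt d
  have hs := (hasDerivAt_iff_tendsto_slope.1 h).eventually_lt_const hd
  filter_upwards [hs.filter_mono (nhdsWithin_mono 0 fun t (ht : 0 < t) => ht.ne'),
    self_mem_nhdsWithin] with t ht ht0
  have ht0 : 0 < t := ht0
  rw [slope_def_field, sub_zero, zero_smul, add_zero, div_lt_iff₀ ht0, zero_mul, sub_neg] at ht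
  exact ht

/-- At a minimum on the boundary of `{f < 0}` with nonnegative outward derivative, the derivative
vanishes. -/
theorem fderiv_eq_zero_of_boundary_min {ν : E} (hf : DifferentiableAt ℝ f x) (hfx : f x = 0)
    (hu : DifferentiableAt ℝ u x) (hmin : ∀ y, f y < 0 → u x ≤ u y)
    (hν : 0 < fderiv ℝ f x ν) (huν : 0 ≤ fderiv ℝ u x ν) : fderiv ℝ u x = 0 := by
  have key (d : E) (hd : fderiv ℝ f x d < 0) : 0 ≤ fderiv ℝ u x d := by
    by_contra! hn
    obtain ⟨t, ht1, ht2⟩ :=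
      ((eventually_lt_of_fderiv_neg hf hd).and (eventually_lt_of_fderiv_neg hu hn)).exists
    rw [hfx] at ht1
    exact absurd (hmin _ ht1) (not_le.2 ht2)
  have hν0 : fderiv ℝ u x ν = 0 := by
    have := key (-ν) (by simpa using hν)
    rw [map_neg] at this
    linarith
  have hnn (d : E) : 0 ≤ fderiv ℝ u x d := by
    have := key (d - ((fderiv ℝ f x d + 1) / fderiv ℝ f x ν) • ν) (by
      rw [map_sub, map_smul, smul_eq_mul, div_mul_cancel₀ _ hν.ne']
      linarith)
    rwa [map_sub, map_smul, hν0, smul_zero, sub_zero] at this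
  ext d
  have := hnn (-d)
  rw [map_neg] at this
  exact le_antisymm (by simpa using this) (hnn d)

end Boundary

section Yamabe

variable {n : ℕ} {Ω O : Set (EuclideanSpace ℝ (Fin n))} {w u : EuclideanSpace ℝ (Fin n) → ℝ}

theorem lap_eq_neg_mul_Rcurv (hn : 3 ≤ n) {U : EuclideanSpace ℝ (Fin n) → ℝ}
    {x : EuclideanSpace ℝ (Fin n)} (hU : 0 < U x) :
    lap U x = -(((n : ℝ) - 2) / (4 * ((n : ℝ) - 1))) * Rcurv n U x *
      U x ^ (((n : ℝ) + 2) / ((n : ℝ) - 2)) := by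
  have hn' : (3 : ℝ) ≤ n := by exact_mod_cast hn
  have h1 : (n : ℝ) - 2 ≠ 0 := by linarith
  have h2 : (n : ℝ) - 1 ≠ 0 := by linarith
  rw [Rcurv, Real.rpow_neg hU.le]
  have := (Real.rpow_pos_of_pos hU (((n : ℝ) + 2) / ((n : ℝ) - 2))).ne'
  field_simp

theorem lap_mul_le_of_Rcurv_le (hn : 3 ≤ n) {x : EuclideanSpace ℝ (Fin n)} (hw : 0 < w x)
    (hu : 0 < u x) (h : Rcurv n w x ≤ Rcurv n (fun y => w y * u y) x) :
    lap (fun y => w y * u y) x ≤ u x ^ (((n : ℝ) + 2) / ((n : ℝ) - 2)) * lap w x := by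
  have hn' : (3 : ℝ) ≤ n := by exact_mod_cast hn
  rw [lap_eq_neg_mul_Rcurv hn (mul_pos hw hu), lap_eq_neg_mul_Rcurv hn hw,
    Real.mul_rpow hw.le hu.le]
  have hc : 0 ≤ ((n : ℝ) - 2) / (4 * ((n : ℝ) - 1)) :=
    div_nonneg (by linarith) (by linarith)
  have hP : 0 ≤ ((n : ℝ) - 2) / (4 * ((n : ℝ) - 1)) *
      (w x ^ (((n : ℝ) + 2) / ((n : ℝ) - 2)) * u x ^ (((n : ℝ) + 2) / ((n : ℝ) - 2))) := by
    positivity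
  nlinarith [mul_le_mul_of_nonneg_left h hP]

theorem mul_lap_eq_neg_mul_Rcurv (hn : 3 ≤ n) {U : EuclideanSpace ℝ (Fin n) → ℝ}
    {x : EuclideanSpace ℝ (Fin n)} (hU : 0 < U x) :
    U x * lap U x = -(((n : ℝ) - 2) / (4 * ((n : ℝ) - 1)) * Rcurv n U x *
      U x ^ ((2 * (n : ℝ)) / ((n : ℝ) - 2))) := by
  have hn' : (3 : ℝ) ≤ n := by exact_mod_cast hn
  have h1 : (n : ℝ) - 2 ≠ 0 := by linarith
  have h2 : (2 * (n : ℝ)) / ((n : ℝ) - 2) = 1 + ((n : ℝ) + 2) / ((n : ℝ) - 2) := by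
    field_simp; ring
  rw [lap_eq_neg_mul_Rcurv hn hU, h2, Real.rpow_add hU, Real.rpow_one]
  ring

theorem ContDiffOn.continuousOn_Rcurv (hO : IsOpen O) (hw : ContDiffOn ℝ ∞ w O)
    (hwpos : ∀ x ∈ O, 0 < w x) : ContinuousOn (Rcurv n w) O :=
  (continuousOn_const.mul (hw.continuousOn.rpow_const fun x hx => Or.inl (hwpos x hx).ne')).mul
    (hw.continuousOn_lap hO)

theorem Qconst_mul_le (hn : 3 ≤ n) (hQ : 0 < Qconst n Ω w)
    {φ : EuclideanSpace ℝ (Fin n) → ℝ} (hφ : ContDiff ℝ ∞ φ) (hc : HasCompactSupport φ)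
    (hs : tsupport φ ⊆ Ω) (hwpos : ∀ x ∈ Ω, 0 < w x) (hΩ : MeasurableSet Ω) :
    Qconst n Ω w * (∫ x in Ω, |φ x| ^ ((2 * (n : ℝ)) / ((n : ℝ) - 2)) *
          (w x) ^ ((2 * (n : ℝ)) / ((n : ℝ) - 2))) ^ (((n : ℝ) - 2) / (n : ℝ)) ≤
      ∫ x in Ω, ((w x) ^ 2 * ‖gradient φ x‖ ^ 2 +
          (((n : ℝ) - 2) / (4 * ((n : ℝ) - 1))) * Rcurv n w x *
            (w x) ^ ((2 * (n : ℝ)) / ((n : ℝ) - 2)) * (φ x) ^ 2) := by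
  have hn' : (3 : ℝ) ≤ n := by exact_mod_cast hn
  have h2 : 0 < (n : ℝ) - 2 := by linarith
  by_cases h0 : φ = 0
  · subst h0
    have hq : (2 * (n : ℝ)) / ((n : ℝ) - 2) ≠ 0 := by positivity
    have hr : ((n : ℝ) - 2) / (n : ℝ) ≠ 0 := by positivity
    have hg (x) : ‖gradient (0 : EuclideanSpace ℝ (Fin n) → ℝ) x‖ = 0 := by
      rw [norm_gradient_eq, fderiv_zero, Pi.zero_apply, norm_zero]
    simp [Real.zero_rpow hq, Real.zero_rpow hr, hg]
  · set N := ∫ x in Ω, ((w x) ^ 2 * ‖gradient φ x‖ ^ 2 +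
          (((n : ℝ) - 2) / (4 * ((n : ℝ) - 1))) * Rcurv n w x *
            (w x) ^ ((2 * (n : ℝ)) / ((n : ℝ) - 2)) * (φ x) ^ 2) with hN
    set D := (∫ x in Ω, |φ x| ^ ((2 * (n : ℝ)) / ((n : ℝ) - 2)) *
          (w x) ^ ((2 * (n : ℝ)) / ((n : ℝ) - 2))) ^ (((n : ℝ) - 2) / (n : ℝ)) with hD
    have hle : Qconst n Ω w ≤ N / D := by
      refine csInf_le ?_ ⟨φ, hφ, hc, hs, h0, rfl⟩
      by_contra hb
      rw [Qconst, Real.sInf_of_not_bddBelow hb] at hQ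
      exact lt_irrefl _ hQ
    have hD0 : 0 ≤ D := Real.rpow_nonneg (setIntegral_nonneg hΩ fun x hx =>
      mul_nonneg (Real.rpow_nonneg (abs_nonneg _) _) (Real.rpow_nonneg (hwpos x hx).le _)) _
    rcases hD0.eq_or_lt with h | h
    · rw [← h, div_zero] at hle
      exact absurd hle (not_le.2 hQ)
    · exact (le_div_iff₀ h).1 hle

/-- Hölder's inequality with exponents `N / 2` and `N / (N - 2)` and a weight. -/
theorem setIntegral_mul_sq_le {N : ℝ} (hN : 2 < N) (hΩo : IsOpen Ω) (hΩ : Bornology.IsBounded Ω)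
    {ρ v : EuclideanSpace ℝ (Fin n) → ℝ} (hρ : ContinuousOn ρ (closure Ω))
    (hv : ContinuousOn v (closure Ω)) (hw : ContinuousOn w (closure Ω)) (hρ0 : ∀ x, 0 ≤ ρ x)
    (hv0 : ∀ x, 0 ≤ v x) (hw0 : ∀ x ∈ closure Ω, 0 < w x) :
    ∫ x in Ω, ρ x * w x ^ (2 * N / (N - 2)) * v x ^ 2 ≤
      (∫ x in Ω, ρ x ^ (N / 2) * w x ^ (2 * N / (N - 2))) ^ (2 / N) *
        (∫ x in Ω, v x ^ (2 * N / (N - 2)) * w x ^ (2 * N / (N - 2))) ^ ((N - 2) / N) := by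
  have h2 : 0 < N - 2 := by linarith
  have hpq : (N / 2).HolderConjugate (N / (N - 2)) := by
    rw [Real.holderConjugate_iff]
    refine ⟨by linarith, ?_⟩
    field_simp
    ring
  have hwΩ : ∀ x ∈ Ω, 0 < w x := fun x hx => hw0 x (subset_closure hx)
  have hwr (r : ℝ) : ContinuousOn (fun x => w x ^ r) (closure Ω) :=
    hw.rpow_const fun x hx => Or.inl (hw0 x hx).ne'
  have h := integral_mul_le_Lp_mul_Lq_of_nonneg (μ := volume.restrict Ω) hpq
    (f := fun x => ρ x * w x ^ (4 / (N - 2))) (g := fun x => v x ^ 2 * w x ^ 2)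
    (ae_restrict_of_forall_mem hΩo.measurableSet fun x hx =>
      mul_nonneg (hρ0 x) (Real.rpow_nonneg (hwΩ x hx).le _))
    (Eventually.of_forall fun x => by positivity)
    ((hρ.fun_mul (hwr _)).memLp_of_isBounded volume hΩ hΩo)
    (((hv.fun_pow 2).fun_mul (hw.fun_pow 2)).memLp_of_isBounded volume hΩ hΩo)
  refine le_of_eq_of_le ?_ (h.trans_eq ?_)
  · refine setIntegral_congr_fun hΩo.measurableSet fun x hx => ?_
    have hq : 2 * N / (N - 2) = 4 / (N - 2) + 2 := by field_simp; ring
    simp only [hq, Real.rpow_add (hwΩ x hx), Real.rpow_two]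
    ring
  · congr 1
    · congr 1
      · refine setIntegral_congr_fun hΩo.measurableSet fun x hx => ?_
        have hw1 := (hwΩ x hx).le
        simp only [Real.mul_rpow (hρ0 x) (Real.rpow_nonneg hw1 _), ← Real.rpow_mul hw1]
        congr 2
        field_simp
        norm_num
      · field_simp
    · congr 1
      · refine setIntegral_congr_fun hΩo.measurableSet fun x hx => ?_
        have hw1 := (hwΩ x hx).le
        have hpow (a : ℝ) (ha : 0 ≤ a) : (a ^ 2) ^ (N / (N - 2)) = a ^ (2 * N / (N - 2)) := by
          rw [← Real.rpow_two, ← Real.rpow_mul ha]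
          congr 1
          ring
        simp only [Real.mul_rpow (sq_nonneg (v x)) (sq_nonneg (w x)), hpow _ (hv0 x), hpow _ hw1]
      · field_simp

/-- The conformal energy of a truncation of `(1 - u)⁺` is controlled by the positive part of the
scalar curvature. -/
theorem setIntegral_energy_le (hn : 3 ≤ n) (hΩo : IsOpen Ω) (hΩ : Bornology.IsBounded Ω)
    (hO : IsOpen O) (hOc : closure Ω ⊆ O) (hw : ContDiffOn ℝ ∞ w O) (hwpos : ∀ x ∈ O, 0 < w x)
    (hu : ContDiffOn ℝ ∞ u O) (hupos : ∀ x ∈ O, 0 < u x)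
    (hcurv : ∀ x ∈ Ω, Rcurv n w x ≤ Rcurv n (fun y => w y * u y) x)
    (hbd : ∀ x ∈ frontier Ω, u x = 1) {ε : ℝ} (hε : 0 < ε) :
    ∫ x in Ω, ((w x) ^ 2 *
          ‖gradient (Ω.indicator (softPosPart ε ∘ fun y => 1 - u y)) x‖ ^ 2 +
          (((n : ℝ) - 2) / (4 * ((n : ℝ) - 1))) * Rcurv n w x *
            (w x) ^ ((2 * (n : ℝ)) / ((n : ℝ) - 2)) *
              (Ω.indicator (softPosPart ε ∘ fun y => 1 - u y) x) ^ 2) ≤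
      ((n : ℝ) + 2) / (4 * ((n : ℝ) - 1)) * ∫ x in Ω, max (Rcurv n w x) 0 *
        (w x) ^ ((2 * (n : ℝ)) / ((n : ℝ) - 2)) * max (1 - u x) 0 ^ 2 := by
  have hn' : (3 : ℝ) ≤ n := by exact_mod_cast hn
  have hΩO : Ω ⊆ O := subset_closure.trans hOc
  set c : ℝ := ((n : ℝ) - 2) / (4 * ((n : ℝ) - 1)) with hc
  set p : ℝ := ((n : ℝ) + 2) / ((n : ℝ) - 2) with hp
  set q : ℝ := (2 * (n : ℝ)) / ((n : ℝ) - 2) with hq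
  have hc0 : 0 < c := div_pos (by linarith) (by linarith)
  have hp1 : 1 ≤ p := by rw [hp, one_le_div (by linarith)]; linarith
  have hcp : ((n : ℝ) + 2) / (4 * ((n : ℝ) - 1)) = c * p := by
    have h1 : (n : ℝ) - 2 ≠ 0 := by linarith
    have h2 : (n : ℝ) - 1 ≠ 0 := by linarith
    rw [hc, hp]
    field_simp
  set h : EuclideanSpace ℝ (Fin n) → ℝ := fun y => 1 - u y with hh
  have hhs : ContDiffOn ℝ ∞ h O := contDiffOn_const.sub hu
  set φ := Ω.indicator (softPosPart ε ∘ h)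
  set s : EuclideanSpace ℝ (Fin n) → ℝ := fun x => softPosPart ε (h x)
  set σ : EuclideanSpace ℝ (Fin n) → ℝ := fun x => smoothTransition (h x / ε - 1)
  have hφs : tsupport φ ⊆ Ω := tsupport_indicator_comp_subset hOc hhs.continuousOn
    (fun x hx => by simp [hh, hbd x hx]) hΩo hε fun t ht => softPosPart_eq_zero hε ht
  have hφd : ContDiff ℝ ∞ φ := contDiff_indicator_of_tsupport_subset hΩo
    ((contDiff_softPosPart ε).comp_contDiffOn (hhs.mono hΩO)) hφs
  have hφ0 : ∀ x ∈ Ω, φ x = s x := fun x hx => indicator_of_mem hx _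
  have hφ' : ∀ x ∈ Ω, ∀ v, fderiv ℝ φ x v = -(σ x * fderiv ℝ u x v) := fun x hx v => by
    have hd : HasFDerivAt h (-fderiv ℝ u x) x :=
      (hu.differentiableAt_of_isOpen hO (hΩO hx)).hasFDerivAt.const_sub 1
    rw [fderiv_indicator_of_mem hΩo hx,
      ((hasDerivAt_softPosPart ε (h x)).comp_hasFDerivAt x hd).fderiv]
    simp [σ]
  have hφg : ∀ x ∈ Ω, ‖gradient φ x‖ ^ 2 = σ x ^ 2 * ‖gradient u x‖ ^ 2 := fun x hx => by
    rw [norm_gradient_sq, norm_gradient_sq, Finset.mul_sum]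
    exact Finset.sum_congr rfl fun i _ => by rw [hφ' x hx]; ring
  -- continuity up to the boundary
  have hwc : ContinuousOn w (closure Ω) := hw.continuousOn.mono hOc
  have huc : ContinuousOn u (closure Ω) := hu.continuousOn.mono hOc
  have hhc : ContinuousOn h (closure Ω) := hhs.continuousOn.mono hOc
  have hsc : ContinuousOn s (closure Ω) := (contDiff_softPosPart ε).continuous.comp_continuousOn hhc
  have hσc : ContinuousOn σ (closure Ω) :=
    (contDiff_smoothTransition_div_sub ε).continuous.comp_continuousOn hhc
  have hRc : ContinuousOn (Rcurv n w) (closure Ω) := (hw.continuousOn_Rcurv hO hwpos).mono hOc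
  have hwq : ContinuousOn (fun x => w x ^ q) (closure Ω) :=
    hwc.rpow_const fun x hx => Or.inl (hwpos x (hOc hx)).ne'
  have hui (i : Fin n) := hu.fderiv_apply_of_isOpen hO (EuclideanSpace.single i 1)
  have hgc : ContinuousOn (fun x => ‖gradient u x‖ ^ 2) (closure Ω) := by
    simp only [norm_gradient_sq]
    exact continuousOn_finsetSum _ fun i _ => ((hui i).continuousOn.mono hOc).pow 2
  have hPc : ContinuousOn (fun x => c * Rcurv n w x * w x ^ q * s x ^ 2) (closure Ω) :=
    (((continuousOn_const.mul hRc).mul hwq).mul (hsc.pow 2))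
  have hDi (i : Fin n) : ContDiffOn ℝ ∞
      (fun y => w y ^ 2 * fderiv ℝ u y (EuclideanSpace.single i 1)) O := (hw.pow 2).mul (hui i)
  set D : EuclideanSpace ℝ (Fin n) → ℝ := fun x => ∑ i,
    fderiv ℝ (fun y => w y ^ 2 * fderiv ℝ u y (EuclideanSpace.single i 1)) x
      (EuclideanSpace.single i 1) with hD
  have hDc : ContinuousOn D (closure Ω) := continuousOn_finsetSum _ fun i _ =>
    ((hDi i).fderiv_apply_of_isOpen hO _).continuousOn.mono hOc
  -- integration by parts
  have hparts : ∫ x in Ω, s x * D x = ∫ x in Ω, σ x * (w x ^ 2 * ‖gradient u x‖ ^ 2) := by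
    have h1 (i : Fin n) : ∫ x in Ω, s x * fderiv ℝ
          (fun y => w y ^ 2 * fderiv ℝ u y (EuclideanSpace.single i 1)) x
            (EuclideanSpace.single i 1) =
        ∫ x in Ω, σ x * (w x ^ 2 * fderiv ℝ u x (EuclideanSpace.single i 1) ^ 2) := by
      have h := setIntegral_mul_fderiv_eq_neg (μ := volume) hΩ hO hOc (hφd.of_le (by norm_num)) hφs
        ((hDi i).of_le (by norm_num)) (EuclideanSpace.single i 1)
      rw [← integral_neg] at h
      refine Eq.trans ?_ (h.trans ?_)
      · exact setIntegral_congr_fun hΩo.measurableSet fun x hx => by simp only [hφ0 x hx]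
      · refine setIntegral_congr_fun hΩo.measurableSet fun x hx => ?_
        simp only [hφ' x hx]
        ring
    simp only [hD, norm_gradient_sq, Finset.mul_sum]
    rw [integral_finsetSum, integral_finsetSum]
    · exact Finset.sum_congr rfl fun i _ => h1 i
    · intro i _
      exact (hσc.fun_mul ((hwc.fun_pow 2).fun_mul
        (((hui i).continuousOn.mono hOc).fun_pow 2))).integrableOn_of_isBounded volume hΩ
    · intro i _
      exact (hsc.fun_mul (((hDi i).fderiv_apply_of_isOpen hO _).continuousOn.mono
        hOc)).integrableOn_of_isBounded volume hΩ
  have hPi := hPc.integrableOn_of_isBounded volume hΩ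
  have hσi : IntegrableOn (fun x => σ x * (w x ^ 2 * ‖gradient u x‖ ^ 2)) Ω :=
    (hσc.fun_mul ((hwc.fun_pow 2).fun_mul hgc)).integrableOn_of_isBounded volume hΩ
  have hsDi : IntegrableOn (fun x => s x * D x) Ω :=
    (hsc.fun_mul hDc).integrableOn_of_isBounded volume hΩ
  calc _ = ∫ x in Ω, (w x ^ 2 * (σ x ^ 2 * ‖gradient u x‖ ^ 2) +
          c * Rcurv n w x * w x ^ q * s x ^ 2) :=
        setIntegral_congr_fun hΩo.measurableSet fun x hx => by
          simp only [hφg x hx, hφ0 x hx]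
    _ ≤ ∫ x in Ω, (σ x * (w x ^ 2 * ‖gradient u x‖ ^ 2) +
          c * Rcurv n w x * w x ^ q * s x ^ 2) := by
        refine setIntegral_mono_on ((((hwc.fun_pow 2).fun_mul
          ((hσc.fun_pow 2).fun_mul hgc)).integrableOn_of_isBounded volume hΩ).add hPi)
          (hσi.add hPi) hΩo.measurableSet fun x hx => ?_
        have h0 : 0 ≤ σ x := smoothTransition.nonneg _
        have h1 : σ x ≤ 1 := smoothTransition.le_one _
        have h2 : σ x ^ 2 ≤ σ x := by nlinarith
        have h3 : 0 ≤ w x ^ 2 * ‖gradient u x‖ ^ 2 := by positivity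
        nlinarith [mul_le_mul_of_nonneg_right h2 h3]
    _ = ∫ x in Ω, (s x * D x + c * Rcurv n w x * w x ^ q * s x ^ 2) := by
        rw [integral_add hσi hPi, ← hparts, ← integral_add hsDi hPi]
    _ ≤ ∫ x in Ω, c * p * (max (Rcurv n w x) 0 * w x ^ q * max (1 - u x) 0 ^ 2) := by
        refine setIntegral_mono_on (hsDi.add hPi) ?_ hΩo.measurableSet fun x hx => ?_
        · refine ContinuousOn.integrableOn_of_isBounded volume hΩ ?_
          exact continuousOn_const.mul (((hRc.sup continuousOn_const).mul hwq).mul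
            ((hhc.sup continuousOn_const).pow 2))
        have hw0 := hwpos x (hΩO hx)
        have hu0 := hupos x (hΩO hx)
        have hs0 : 0 ≤ s x := softPosPart_nonneg hε _
        have hs1 : s x ≤ max (1 - u x) 0 := softPosPart_le_max hε _
        have hwq0 : 0 ≤ w x ^ q := Real.rpow_nonneg hw0.le _
        set R := Rcurv n w x with hR
        have hDle : D x ≤ c * R * w x ^ q * (u x - u x ^ p) := by
          have e1 := mul_le_mul_of_nonneg_left (lap_mul_le_of_Rcurv_le hn hw0 hu0 (hcurv x hx))
            hw0.le
          have e2 := mul_lap_eq_neg_mul_Rcurv hn hw0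
          simp only [hD]
          rw [sum_fderiv_sq_mul_fderiv hO hw hu (hΩO hx)]
          calc w x * lap (fun y => w y * u y) x - u x * w x * lap w x
              ≤ w x * (u x ^ p * lap w x) - u x * w x * lap w x := by linarith
            _ = -(w x * lap w x) * (u x - u x ^ p) := by ring
            _ = c * R * w x ^ q * (u x - u x ^ p) := by rw [e2, neg_neg]
        rcases le_total 1 (u x) with h1 | h1
        · rw [max_eq_right (a := 1 - u x) (b := 0) (by linarith)] at hs1 ⊢
          have : s x = 0 := le_antisymm hs1 hs0
          simp [this]
        · rw [max_eq_left (a := 1 - u x) (b := 0) (by linarith)] at hs1 ⊢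
          have hb : 1 + p * (u x - 1) ≤ u x ^ p := by
            have := one_add_mul_self_le_rpow_one_add (s := u x - 1) (by linarith) hp1
            rwa [add_sub_cancel] at this
          have hpu : u x ^ p ≤ u x := by
            simpa using Real.rpow_le_rpow_of_exponent_ge hu0 h1 hp1
          have hRp : 0 ≤ max R 0 := le_max_right _ _
          calc s x * D x + c * R * w x ^ q * s x ^ 2
              ≤ s x * (c * R * w x ^ q * (u x - u x ^ p)) + c * R * w x ^ q * s x ^ 2 := by
                gcongr
            _ = c * (R * w x ^ q * (s x * (u x - u x ^ p + s x))) := by ring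
            _ ≤ c * (max R 0 * w x ^ q * (s x * (u x - u x ^ p + s x))) := by
                have : 0 ≤ s x * (u x - u x ^ p + s x) := mul_nonneg hs0 (by linarith)
                gcongr
                exact le_max_left _ _
            _ ≤ c * (max R 0 * w x ^ q * ((1 - u x) * (p * (1 - u x)))) := by
                have h3 : u x - u x ^ p + s x ≤ p * (1 - u x) := by linarith
                have h4 : 0 ≤ u x - u x ^ p + s x := by linarith
                have h5 : 0 ≤ 1 - u x := by linarith
                gcongr
            _ = c * p * (max R 0 * w x ^ q * (1 - u x) ^ 2) := by ring
    _ = _ := by rw [integral_const_mul, hcp]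

theorem one_le_of_Rcurv_le (hn : 3 ≤ n) (hΩo : IsOpen Ω) (hΩ : Bornology.IsBounded Ω)
    (hO : IsOpen O) (hOc : closure Ω ⊆ O) (hw : ContDiffOn ℝ ∞ w O) (hwpos : ∀ x ∈ O, 0 < w x)
    (hu : ContDiffOn ℝ ∞ u O) (hupos : ∀ x ∈ O, 0 < u x)
    (hcurv : ∀ x ∈ Ω, Rcurv n w x ≤ Rcurv n (fun y => w y * u y) x)
    (hbd : ∀ x ∈ frontier Ω, u x = 1) (hQpos : 0 < Qconst n Ω w)
    (hQ : (((n : ℝ) + 2) / (4 * ((n : ℝ) - 1))) *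
        (∫ x in Ω, (max (Rcurv n w x) 0) ^ ((n : ℝ) / 2) *
          (w x) ^ ((2 * (n : ℝ)) / ((n : ℝ) - 2))) ^ ((2 : ℝ) / (n : ℝ))
        < Qconst n Ω w) : ∀ x ∈ Ω, 1 ≤ u x := by
  have hn' : (3 : ℝ) ≤ n := by exact_mod_cast hn
  have h2 : 0 < (n : ℝ) - 2 := by linarith
  have hΩO : Ω ⊆ O := subset_closure.trans hOc
  set q : ℝ := (2 * (n : ℝ)) / ((n : ℝ) - 2) with hq
  have hq0 : 0 < q := by positivity
  set v : EuclideanSpace ℝ (Fin n) → ℝ := fun x => max (1 - u x) 0 with hv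
  have hv0 (x) : 0 ≤ v x := le_max_right _ _
  have hwc : ContinuousOn w (closure Ω) := hw.continuousOn.mono hOc
  have hhc : ContinuousOn (fun x => 1 - u x) (closure Ω) :=
    continuousOn_const.sub (hu.continuousOn.mono hOc)
  have hvc : ContinuousOn v (closure Ω) := hhc.sup continuousOn_const
  have hRc : ContinuousOn (Rcurv n w) (closure Ω) := (hw.continuousOn_Rcurv hO hwpos).mono hOc
  have hwq : ContinuousOn (fun x => w x ^ q) (closure Ω) :=
    hwc.rpow_const fun x hx => Or.inl (hwpos x (hOc hx)).ne'
  have hvw : ContinuousOn (fun x => v x ^ q * w x ^ q) (closure Ω) :=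
    (hvc.rpow_const fun x _ => Or.inr hq0.le).fun_mul hwq
  have hvwi : IntegrableOn (fun x => v x ^ q * w x ^ q) Ω :=
    hvw.integrableOn_of_isBounded volume hΩ
  set I := ∫ x in Ω, v x ^ q * w x ^ q with hI
  set r : ℝ := ((n : ℝ) - 2) / n with hr
  have hr0 : 0 < r := by positivity
  set A := ∫ x in Ω, (max (Rcurv n w x) 0) ^ ((n : ℝ) / 2) * (w x) ^ q
  set k : ℝ := ((n : ℝ) + 2) / (4 * ((n : ℝ) - 1))
  have hk : 0 ≤ k := div_nonneg (by linarith) (by linarith)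
  have hholder : k * ∫ x in Ω, max (Rcurv n w x) 0 * w x ^ q * v x ^ 2 ≤
      k * A ^ ((2 : ℝ) / n) * I ^ r := by
    rw [mul_assoc]
    exact mul_le_mul_of_nonneg_left (setIntegral_mul_sq_le (by linarith) hΩo hΩ
      (hRc.sup continuousOn_const) hvc hwc (fun x => le_max_right _ _) hv0
      fun x hx => hwpos x (hOc hx)) hk
  have hbound : ∀ᶠ ε in 𝓝[>] (0 : ℝ), Qconst n Ω w *
      (∫ x in Ω, softPosPart ε (1 - u x) ^ q * w x ^ q) ^ r ≤ k * A ^ ((2 : ℝ) / n) * I ^ r := by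
    filter_upwards [self_mem_nhdsWithin] with ε hε
    have hε : 0 < ε := hε
    have hφs : tsupport (Ω.indicator (softPosPart ε ∘ fun y => 1 - u y)) ⊆ Ω :=
      tsupport_indicator_comp_subset hOc (continuousOn_const.sub hu.continuousOn)
        (fun x hx => by simp [hbd x hx]) hΩo hε fun t ht => softPosPart_eq_zero hε ht
    have hφd : ContDiff ℝ ∞ (Ω.indicator (softPosPart ε ∘ fun y => 1 - u y)) :=
      contDiff_indicator_of_tsupport_subset hΩo
        ((contDiff_softPosPart ε).comp_contDiffOn ((contDiffOn_const.sub hu).mono hΩO)) hφs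
    have hφc : HasCompactSupport (Ω.indicator (softPosPart ε ∘ fun y => 1 - u y)) :=
      hΩ.isCompact_closure.of_isClosed_subset (isClosed_tsupport _)
        (hφs.trans subset_closure)
    have h1 := Qconst_mul_le hn hQpos hφd hφc hφs (fun x hx => hwpos x (hΩO hx)) hΩo.measurableSet
    have h3 := setIntegral_energy_le hn hΩo hΩ hO hOc hw hwpos hu hupos hcurv hbd hε
    refine le_trans (le_of_eq ?_) ((h1.trans h3).trans hholder)
    congr 2
    refine setIntegral_congr_fun hΩo.measurableSet fun x hx => ?_
    simp only [indicator_of_mem hx, Function.comp_apply, abs_of_nonneg (softPosPart_nonneg hε _)]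
    rfl
  have hlim : Tendsto (fun ε => ∫ x in Ω, softPosPart ε (1 - u x) ^ q * w x ^ q) (𝓝[>] 0)
      (𝓝 I) := by
    refine tendsto_integral_filter_of_dominated_convergence (fun x => v x ^ q * w x ^ q)
      (Eventually.of_forall fun ε => ?_) ?_ hvwi ?_
    · exact (((((contDiff_softPosPart ε).continuous.comp_continuousOn hhc).rpow_const
        fun x _ => Or.inr hq0.le).fun_mul hwq).integrableOn_of_isBounded volume
          hΩ).aestronglyMeasurable
    · filter_upwards [self_mem_nhdsWithin] with ε hε
      refine ae_restrict_of_forall_mem hΩo.measurableSet fun x hx => ?_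
      have hw0 := Real.rpow_nonneg (hwpos x (hΩO hx)).le q
      have hs0 := softPosPart_nonneg hε (1 - u x)
      rw [Real.norm_of_nonneg (mul_nonneg (Real.rpow_nonneg hs0 _) hw0)]
      exact mul_le_mul_of_nonneg_right
        (Real.rpow_le_rpow hs0 (softPosPart_le_max hε _) hq0.le) hw0
    · refine ae_restrict_of_forall_mem hΩo.measurableSet fun x hx => ?_
      exact ((tendsto_softPosPart (1 - u x)).rpow_const (Or.inr hq0.le)).mul_const _
  have hfin := le_of_tendsto ((hlim.rpow_const (Or.inr hr0.le)).const_mul (Qconst n Ω w)) hbound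
  have hnn : 0 ≤ᵐ[volume.restrict Ω] fun x => v x ^ q * w x ^ q :=
    ae_restrict_of_forall_mem hΩo.measurableSet fun x hx =>
      mul_nonneg (Real.rpow_nonneg (hv0 x) _) (Real.rpow_nonneg (hwpos x (hΩO hx)).le _)
  have hI0 : 0 ≤ I := integral_nonneg_of_ae hnn
  have hIz : I = 0 := by
    by_contra hne
    have hIr : 0 < I ^ r := Real.rpow_pos_of_pos (lt_of_le_of_ne hI0 (Ne.symm hne)) r
    exact absurd (le_of_mul_le_mul_right hfin hIr) (not_le.2 hQ)
  have heq := Measure.eqOn_open_of_ae_eq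
    ((setIntegral_eq_zero_iff_of_nonneg_ae hnn hvwi).1 hIz) hΩo (hvw.mono subset_closure)
    continuousOn_const
  intro x hx
  have h4 : v x ^ q * w x ^ q = 0 := heq hx
  have h5 : v x = 0 := by
    rcases mul_eq_zero.1 h4 with h | h
    · exact (Real.rpow_eq_zero (hv0 x) hq0.ne').1 h
    · exact absurd h (Real.rpow_pos_of_pos (hwpos x (hΩO hx)) q).ne'
  have h6 : 1 - u x ≤ v x := le_max_left _ _
  linarith

theorem rpow_sub_one_le {t p : ℝ} (ht : 1 ≤ t) (hp : 1 ≤ p) :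
    t ^ p - 1 ≤ p * t ^ p * (t - 1) := by
  have ht0 : 0 < t := by linarith
  have h := one_add_mul_self_le_rpow_one_add (s := t⁻¹ - 1) (by linarith [inv_pos.2 ht0]) hp
  rw [add_sub_cancel, Real.inv_rpow ht0.le] at h
  have hP : 0 < t ^ p := Real.rpow_pos_of_pos ht0 p
  have h1 := mul_le_mul_of_nonneg_left h hP.le
  rw [mul_inv_cancel₀ hP.ne'] at h1
  have h2 : 1 - t⁻¹ ≤ t - 1 := by
    have : 1 - t⁻¹ = (t - 1) / t := by field_simp
    rw [this]
    exact div_le_self (by linarith) ht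
  have h3 := mul_le_mul_of_nonneg_left h2 (by positivity : 0 ≤ p * t ^ p)
  nlinarith

end Yamabe

/-- Conformally flat case of Theorem 2.1: if `R[w·u] ≥ R[w]` on `Ω`, `u = 1` on `∂Ω`,
`∂u/∂ν ≥ 0` on `∂Ω`, `Q(Ω,w) > 0` and
`((n+2)/(4(n-1))) (∫_Ω (R[w]⁺)^{n/2} w^{2n/(n-2)})^{2/n} < Q(Ω,w)`, then `u ≡ 1` on `Ω`. -/
theorem stmt_0 (n : ℕ) (hn : 3 ≤ n)
    (Ω : Set (EuclideanSpace ℝ (Fin n))) (hΩo : IsOpen Ω)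
    (hΩb : Bornology.IsBounded Ω)
    (ν : EuclideanSpace ℝ (Fin n) → EuclideanSpace ℝ (Fin n))
    (hsb : SmoothBoundaryNormal Ω ν)
    (w u : EuclideanSpace ℝ (Fin n) → ℝ)
    (U V : Set (EuclideanSpace ℝ (Fin n)))
    (hU : IsOpen U) (hUc : closure Ω ⊆ U)
    (hw : ContDiffOn ℝ (⊤ : ℕ∞) w U) (hwpos : ∀ x ∈ U, 0 < w x)
    (hV : IsOpen V) (hVc : closure Ω ⊆ V)
    (hu : ContDiffOn ℝ (⊤ : ℕ∞) u V) (hupos : ∀ x ∈ V, 0 < u x)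
    (hcurv : ∀ x ∈ Ω, Rcurv n w x ≤ Rcurv n (fun y => w y * u y) x)
    (hbd1 : ∀ x ∈ frontier Ω, u x = 1)
    (hbd2 : ∀ x ∈ frontier Ω, 0 ≤ fderiv ℝ u x (ν x))
    (hQpos : 0 < Qconst n Ω w)
    (hQ : (((n : ℝ) + 2) / (4 * ((n : ℝ) - 1))) *
        (∫ x in Ω, (max (Rcurv n w x) 0) ^ ((n : ℝ) / 2) *
          (w x) ^ ((2 * (n : ℝ)) / ((n : ℝ) - 2))) ^ ((2 : ℝ) / (n : ℝ))
        < Qconst n Ω w) :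
    ∀ x ∈ Ω, u x = 1 := by
  obtain ⟨f, hf, hΩf, hfrf, hgrad⟩ := hsb
  have hn' : (3 : ℝ) ≤ n := by exact_mod_cast hn
  have hO : IsOpen (U ∩ V) := hU.inter hV
  have hOc : closure Ω ⊆ U ∩ V := subset_inter hUc hVc
  have hΩO : Ω ⊆ U ∩ V := subset_closure.trans hOc
  replace hw : ContDiffOn ℝ ∞ w (U ∩ V) := hw.mono inter_subset_left
  replace hu : ContDiffOn ℝ ∞ u (U ∩ V) := hu.mono inter_subset_right
  replace hwpos : ∀ x ∈ U ∩ V, 0 < w x := fun x hx => hwpos x hx.1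
  replace hupos : ∀ x ∈ U ∩ V, 0 < u x := fun x hx => hupos x hx.2
  have hu1 := one_le_of_Rcurv_le hn hΩo hΩb hO hOc hw hwpos hu hupos hcurv hbd1 hQpos hQ
  have hfrO : ∀ x ∈ frontier Ω, x ∈ U ∩ V := fun x hx => hOc (frontier_subset_closure hx)
  have hdu : ∀ x ∈ frontier Ω, fderiv ℝ u x = 0 := by
    intro x hx
    obtain ⟨hg0, hν⟩ := hgrad x hx
    refine fderiv_eq_zero_of_boundary_min (f := f) (hf.differentiable (by norm_num) x)
      (by rw [hfrf] at hx; exact hx) (hu.differentiableAt_of_isOpen hO (hfrO x hx))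
      (fun y hy => ?_) ?_ (hbd2 x hx)
    · rw [hbd1 x hx]
      exact hu1 y (by rw [hΩf]; exact hy)
    · have h : fderiv ℝ f x (gradient f x) = ‖gradient f x‖ ^ 2 := by
        rw [← real_inner_self_eq_norm_sq]
        nth_rewrite 2 [gradient]
        rw [InnerProductSpace.toDual_symm_apply]
      have := norm_pos_iff.2 hg0
      rw [hν, map_smul, h, smul_eq_mul]
      positivity
  set p : ℝ := ((n : ℝ) + 2) / ((n : ℝ) - 2) with hp
  have hp1 : 1 ≤ p := by rw [hp, one_le_div (by linarith)]; linarith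
  have hwu : ContDiffOn ℝ ∞ (fun y => w y * u y) (U ∩ V) := hw.mul hu
  obtain ⟨K, hK⟩ := hΩb.isCompact_closure.exists_bound_of_continuousOn
    (f := fun x => |lap w x| * (p * u x ^ p) / w x)
    (((((hw.continuousOn_lap hO).abs).mul (continuousOn_const.mul
      (hu.continuousOn.rpow_const fun x hx => Or.inl (hupos x hx).ne'))).div hw.continuousOn
        fun x hx => (hwpos x hx).ne').mono hOc)
  have hW := eq_zero_of_lap_le_of_cauchy_data_eq_zero (W := fun y => w y * u y - w y) (K := |K|)
    hΩo hΩb hO hOc (hwu.sub hw) ⟨0, by omega⟩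
    (fun x hx => by nlinarith [hu1 x hx, hwpos x (hΩO hx)])
    (fun x hx => by simp [hbd1 x hx]) ?_ (abs_nonneg K) ?_
  · intro x hx
    have hw0 := hwpos x (hΩO hx)
    have h : w x * (u x - 1) = 0 := by linarith [hW x hx]
    rcases mul_eq_zero.1 h with h | h
    · exact absurd h hw0.ne'
    · linarith
  · intro x hx
    have dw := hw.differentiableAt_of_isOpen hO (hfrO x hx)
    have du := hu.differentiableAt_of_isOpen hO (hfrO x hx)
    rw [fderiv_fun_sub (dw.fun_mul du) dw, fderiv_fun_mul dw du, hdu x hx, hbd1 x hx]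
    simp
  · intro x hx
    have hw0 := hwpos x (hΩO hx)
    have hu0 := hupos x (hΩO hx)
    have h1 := hu1 x hx
    rw [lap_sub hO hwu hw (hΩO hx)]
    have hb : |lap w x| * (p * u x ^ p) / w x ≤ |K| :=
      (le_abs_self _).trans ((hK x (subset_closure hx)).trans (le_abs_self K))
    have hW0 : 0 ≤ w x * (u x - 1) := mul_nonneg hw0.le (by linarith)
    have hup : 0 ≤ u x ^ p - 1 := by linarith [Real.one_le_rpow h1 (by linarith : 0 ≤ p)]
    calc lap (fun y => w y * u y) x - lap w x
        ≤ u x ^ p * lap w x - lap w x := by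
          linarith [lap_mul_le_of_Rcurv_le hn hw0 hu0 (hcurv x hx)]
      _ = lap w x * (u x ^ p - 1) := by ring
      _ ≤ |lap w x| * (p * u x ^ p * (u x - 1)) :=
          mul_le_mul (le_abs_self _) (rpow_sub_one_le h1 hp1) hup (abs_nonneg _)
      _ = |lap w x| * (p * u x ^ p) / w x * (w x * (u x - 1)) := by field_simp
      _ ≤ |K| * (w x * (u x - 1)) := mul_le_mul_of_nonneg_right hb hW0
      _ = |K| * (w x * u x - w x) := by ring
end

section
/- Let n ≥ 2 be an integer, let Ω ⊂ ℝⁿ be a bounded open set, and let λ be a real number. Suppose u₁ is a smooth function on Ω with u₁ > 0 on Ω and Δu₁ + λu₁ = 0 on Ω. Let A : Ω → ℝ be continuous and let v be a C² function on Ω, continuous on the closure of Ω, such that: (i) Δv + A·v ≤ 0 on Ω; (ii) v = 0 on ∂Ω; (iii) A(x) < λ at every x ∈ Ω with v(x) ≤ 0; (iv) the quotient β := v/u₁ extends to a continuous function on the closure of Ω vanishing on ∂Ω. Then v ≥ 0 on Ω. -/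
open MeasureTheory Real

open Filter Topology

section SecondDerivative

variable {E : Type*} [NormedAddCommGroup E] [NormedSpace ℝ E] {f : E → ℝ} {p : E}

/-- The second derivative of a real function at a local minimum is nonnegative. -/
lemma IsLocalMin.deriv_deriv_nonneg {g : ℝ → ℝ} {t : ℝ} (hmin : IsLocalMin g t)
    (hg : ContinuousAt g t) : 0 ≤ deriv (deriv g) t := by
  by_contra! hneg
  have hmax : IsLocalMax g t := isLocalMax_of_deriv_deriv_neg hneg hmin.deriv_eq_zero hg
  have hconst : g =ᶠ[𝓝 t] fun _ => g t := by
    filter_upwards [hmin, hmax] with s h₁ h₂ using le_antisymm h₂ h₁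
  have hzero : deriv (deriv g) t = 0 := by
    rw [hconst.deriv.deriv_eq]
    simp
  exact hneg.ne hzero

/-- Directional derivatives of a `C²` function are differentiable. -/
lemma ContDiffAt.differentiableAt_fderiv_apply (hf : ContDiffAt ℝ 2 f p) (e : E) :
    DifferentiableAt ℝ (fun y => fderiv ℝ f y e) p :=
  ((hf.fderiv_right (m := 1) (by norm_num)).differentiableAt one_ne_zero).clm_apply
    (differentiableAt_const e)

/-- A `C²` function is differentiable in a neighbourhood. -/
lemma ContDiffAt.eventually_differentiableAt_of_two (hf : ContDiffAt ℝ 2 f p) :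
    ∀ᶠ y in 𝓝 p, DifferentiableAt ℝ f y :=
  (hf.eventually (by simp)).mono fun _ hy => hy.differentiableAt two_ne_zero

/-- Second directional derivatives of a `C²` function at a local minimum are nonnegative. -/
lemma IsLocalMin.fderiv_fderiv_apply_nonneg (hmin : IsLocalMin f p) (hf : ContDiffAt ℝ 2 f p)
    (e : E) : 0 ≤ fderiv ℝ (fun y => fderiv ℝ f y e) p e := by
  have hline (t : ℝ) : HasDerivAt (fun s : ℝ => p + s • e) e t := by
    simpa using ((hasDerivAt_id t).smul_const e).const_add p
  have hp : p + (0 : ℝ) • e = p := by simp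
  have htend : Tendsto (fun s : ℝ => p + s • e) (𝓝 0) (𝓝 p) := by
    simpa using (hline 0).continuousAt.tendsto
  have hderiv : deriv (fun s : ℝ => f (p + s • e)) =ᶠ[𝓝 0]
      fun s => fderiv ℝ f (p + s • e) e := by
    filter_upwards [htend.eventually hf.eventually_differentiableAt_of_two] with s hs
    exact (hs.hasFDerivAt.comp_hasDerivAt s (hline s)).deriv
  have hsecond : deriv (deriv fun s : ℝ => f (p + s • e)) 0 =
      fderiv ℝ (fun y => fderiv ℝ f y e) p e := by
    rw [hderiv.deriv_eq]
    exact ((hf.differentiableAt_fderiv_apply e).hasFDerivAt.comp_hasDerivAt_of_eq 0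
      (hline 0) hp.symm).deriv
  rw [← hsecond]
  refine IsLocalMin.deriv_deriv_nonneg ?_ ?_
  · filter_upwards [htend.eventually hmin] with s hs
    simpa using hs
  · exact ContinuousAt.comp_of_eq hf.continuousAt (hline 0).continuousAt hp

end SecondDerivative

section Laplacian

variable {n : ℕ} {f g : EuclideanSpace ℝ (Fin n) → ℝ} {p : EuclideanSpace ℝ (Fin n)}

/-- The Laplacian of a `C²` function at a local minimum is nonnegative. -/
lemma IsLocalMin.lap_nonneg (hmin : IsLocalMin f p) (hf : ContDiffAt ℝ 2 f p) : 0 ≤ lap f p :=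
  Finset.sum_nonneg fun _ _ => hmin.fderiv_fderiv_apply_nonneg hf _

lemma lap_sub_const_mul (hf : ContDiffAt ℝ 2 f p) (hg : ContDiffAt ℝ 2 g p) (c : ℝ) :
    lap (fun y => f y - c * g y) p = lap f p - c * lap g p := by
  unfold lap
  rw [Finset.mul_sum, ← Finset.sum_sub_distrib]
  refine Finset.sum_congr rfl fun i _ => ?_
  set e : EuclideanSpace ℝ (Fin n) := EuclideanSpace.single i 1
  have hfirst : (fun y => fderiv ℝ (fun z => f z - c * g z) y e) =ᶠ[𝓝 p]
      fun y => fderiv ℝ f y e - c * fderiv ℝ g y e := by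
    filter_upwards [hf.eventually_differentiableAt_of_two,
      hg.eventually_differentiableAt_of_two] with y hfy hgy
    rw [(hfy.hasFDerivAt.fun_sub (hgy.hasFDerivAt.const_mul c)).fderiv]
    simp
  rw [hfirst.fderiv_eq, ((hf.differentiableAt_fderiv_apply e).hasFDerivAt.fun_sub
    ((hg.differentiableAt_fderiv_apply e).hasFDerivAt.const_mul c)).fderiv]
  simp

end Laplacian

/-- Ground-state maximum principle: if `u₁ > 0` solves `Δu₁ + λu₁ = 0` on `Ω`,
`v` satisfies `Δv + Av ≤ 0` on `Ω`, `v = 0` on `∂Ω`, `A < λ` where `v ≤ 0`, and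
`β = v/u₁` extends continuously to `closure Ω` vanishing on `∂Ω`, then `v ≥ 0` on `Ω`. -/
theorem stmt_7 (n : ℕ) (hn : 2 ≤ n)
    (Ω : Set (EuclideanSpace ℝ (Fin n))) (hΩo : IsOpen Ω)
    (hΩb : Bornology.IsBounded Ω) (lam : ℝ)
    (u₁ : EuclideanSpace ℝ (Fin n) → ℝ)
    (hu₁ : ContDiffOn ℝ (⊤ : ℕ∞) u₁ Ω)
    (hu₁pos : ∀ x ∈ Ω, 0 < u₁ x)
    (hu₁eq : ∀ x ∈ Ω, lap u₁ x + lam * u₁ x = 0)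
    (A : EuclideanSpace ℝ (Fin n) → ℝ) (hA : ContinuousOn A Ω)
    (v : EuclideanSpace ℝ (Fin n) → ℝ)
    (hv : ContDiffOn ℝ 2 v Ω) (hvc : ContinuousOn v (closure Ω))
    (hineq : ∀ x ∈ Ω, lap v x + A x * v x ≤ 0)
    (hbd : ∀ x ∈ frontier Ω, v x = 0)
    (hAlt : ∀ x ∈ Ω, v x ≤ 0 → A x < lam)
    (β : EuclideanSpace ℝ (Fin n) → ℝ)
    (hβc : ContinuousOn β (closure Ω))
    (hβeq : ∀ x ∈ Ω, v x = u₁ x * β x)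
    (hβbd : ∀ x ∈ frontier Ω, β x = 0) :
    ∀ x ∈ Ω, 0 ≤ v x := by
  intro x hx
  by_contra! hvx
  have hβx : β x < 0 := by
    have h := hβeq x hx
    by_contra! hβ
    nlinarith [mul_nonneg (hu₁pos x hx).le hβ]
  obtain ⟨p, hpc, hp⟩ := hΩb.isCompact_closure.exists_isMinOn ⟨x, subset_closure hx⟩ hβc
  have hβp : β p < 0 := (hp (subset_closure hx)).trans_lt hβx
  have hpΩ : p ∈ Ω := by
    by_contra hpn
    exact hβp.ne (hβbd p ⟨hpc, by rwa [hΩo.interior_eq]⟩)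
  have hnhds : Ω ∈ 𝓝 p := hΩo.mem_nhds hpΩ
  have hvp : ContDiffAt ℝ 2 v p := hv.contDiffAt hnhds
  have hup : ContDiffAt ℝ 2 u₁ p := contDiffAt_infty.1 (hu₁.contDiffAt hnhds) 2
  have hmin : IsLocalMin (fun y => v y - β p * u₁ y) p := by
    filter_upwards [hnhds] with y hy
    have hβy : β p ≤ β y := hp (subset_closure hy)
    rw [hβeq y hy, hβeq p hpΩ]
    nlinarith [mul_le_mul_of_nonneg_left hβy (hu₁pos y hy).le]
  have hlap := hmin.lap_nonneg (hvp.sub (contDiffAt_const.mul hup))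
  rw [lap_sub_const_mul hvp hup] at hlap
  have hvneg : v p < 0 := hβeq p hpΩ ▸ mul_neg_of_pos_of_neg (hu₁pos p hpΩ) hβp
  have hpos := mul_pos_of_neg_of_neg (sub_neg.2 (hAlt p hpΩ hvneg.le)) hvneg
  have hu : lap u₁ p = -(lam * u₁ p) := eq_neg_of_add_eq_zero_left (hu₁eq p hpΩ)
  rw [hu] at hlap
  have hveq : lam * v p = lam * (u₁ p * β p) := by rw [hβeq p hpΩ]
  linarith [hineq p hpΩ]
end
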